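/- Let X be a Banach function space over ℝⁿ with x ↦ 1/(1+|x|ⁿ) ∈ X, assume M is bounded on MX (‖MMf‖_X ≤ C₀‖Mf‖_X for all f), and suppose the Coifman–Fefferman inequality ‖R_j^⋆ f‖_X ≤ C‖Mf‖_X holds for each maximal Riesz transform R_j^⋆, j = 1,…,n. Then each maximal Riesz transform R_j^⋆ is bounded on the space MX, i.e. there is a constant C'' with ‖M(R_j^⋆ f)‖_X ≤ C''‖Mf‖_X for all measurable f and each j = 1,…,n. -/

import Mathlib

open MeasureTheory Filter Topology Bornology ENNReal NNReal

noncomputable section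

/-- Euclidean space `ℝⁿ`. -/
abbrev Rn (n : ℕ) : Type := EuclideanSpace ℝ (Fin n)

/-- Axis-parallel closed cube with center `c` and half side-length `r`. -/
def Cube {n : ℕ} (c : Rn n) (r : ℝ) : Set (Rn n) := {y | ∀ i, |y i - c i| ≤ r}

/-- The Hardy–Littlewood maximal operator (over cubes), acting on
`ℝ≥0∞`-valued functions: `Mf(x) = sup_{Q ∋ x} (1/|Q|) ∫_Q f`. -/
def maximal {n : ℕ} (f : Rn n → ℝ≥0∞) (x : Rn n) : ℝ≥0∞ :=
  ⨆ (c : Rn n) (r : ℝ) (_ : 0 < r) (_ : x ∈ Cube c r),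
    (volume (Cube c r))⁻¹ * ∫⁻ y in Cube c r, f y

/-- The Hardy–Littlewood maximal operator of a real-valued function. -/
def maximalR {n : ℕ} (f : Rn n → ℝ) : Rn n → ℝ≥0∞ :=
  maximal fun y => (‖f y‖₊ : ℝ≥0∞)

/-- The Fefferman–Stein sharp maximal function
`f^#(x) = sup_{Q ∋ x} (1/|Q|) ∫_Q |f - f_Q|`. -/
def sharpMaximal {n : ℕ} (f : Rn n → ℝ) (x : Rn n) : ℝ≥0∞ :=
  ⨆ (c : Rn n) (r : ℝ) (_ : 0 < r) (_ : x ∈ Cube c r),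
    (volume (Cube c r))⁻¹ *
      ∫⁻ y in Cube c r, (‖f y - ⨍ z in Cube c r, f z‖₊ : ℝ≥0∞)

/-- A Banach function space norm over `ℝⁿ` (with Lebesgue measure), given by a
functional `ρ` on nonnegative (`ℝ≥0∞`-valued) functions satisfying the axioms
(i)-(v) of a BFS norm. -/
structure BFSNorm (n : ℕ) where
  ρ : (Rn n → ℝ≥0∞) → ℝ≥0∞
  eq_zero_iff : ∀ f : Rn n → ℝ≥0∞, Measurable f → (ρ f = 0 ↔ f =ᵐ[volume] 0)
  smul : ∀ (f : Rn n → ℝ≥0∞) (a : ℝ≥0), ρ (fun x => (a : ℝ≥0∞) * f x) = a * ρ f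
  add_le : ∀ f g : Rn n → ℝ≥0∞, ρ (fun x => f x + g x) ≤ ρ f + ρ g
  mono : ∀ f g : Rn n → ℝ≥0∞, (∀ᵐ x ∂volume, f x ≤ g x) → ρ f ≤ ρ g
  sup_eq : ∀ (F : ℕ → Rn n → ℝ≥0∞) (f : Rn n → ℝ≥0∞),
    (∀ᵐ x ∂volume, Monotone fun k => F k x) →
    (∀ᵐ x ∂volume, (⨆ k, F k x) = f x) → ρ f = ⨆ k, ρ (F k)
  indicator_lt_top : ∀ E : Set (Rn n), MeasurableSet E → IsBounded E →
    ρ (E.indicator 1) < ⊤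
  int_le : ∀ E : Set (Rn n), MeasurableSet E → IsBounded E →
    ∃ cE : ℝ≥0, ∀ f : Rn n → ℝ≥0∞, Measurable f →
      (∫⁻ x in E, f x) ≤ (cE : ℝ≥0∞) * ρ f

/-- The `X`-norm of a real-valued function `f`, i.e. `ρ(|f|)`. -/
def BFSNorm.normR {n : ℕ} (X : BFSNorm n) (f : Rn n → ℝ) : ℝ≥0∞ :=
  X.ρ fun x => (‖f x‖₊ : ℝ≥0∞)

/-- The associate space norm `‖f‖_{X'} = sup { ∫ f g : ‖g‖_X ≤ 1 }`. -/
def assocNorm {n : ℕ} (ρ : (Rn n → ℝ≥0∞) → ℝ≥0∞) (f : Rn n → ℝ≥0∞) : ℝ≥0∞ :=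
  ⨆ (g : Rn n → ℝ≥0∞) (_ : Measurable g) (_ : ρ g ≤ 1), ∫⁻ x, f x * g x

/-- The norm of the space `MX`: `‖f‖_{MX} = ‖Mf‖_X`. -/
def MXnorm {n : ℕ} (X : BFSNorm n) : (Rn n → ℝ≥0∞) → ℝ≥0∞ :=
  fun f => X.ρ (maximal f)

/-- The constant `c_n = Γ((n+1)/2) / π^((n+1)/2)` in the Riesz transforms. -/
def rieszConst (n : ℕ) : ℝ :=
  Real.Gamma (((n : ℝ) + 1) / 2) / Real.pi ^ (((n : ℝ) + 1) / 2)

/-- The truncated Riesz transform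
`R_{j,ε} f(x) = c_n ∫_{|y| > ε} f(x-y) y_j / |y|^{n+1} dy`. -/
def rieszTrunc {n : ℕ} (j : Fin n) (ε : ℝ) (f : Rn n → ℝ) (x : Rn n) : ℝ :=
  rieszConst n * ∫ y in {y : Rn n | ε < ‖y‖}, f (x - y) * (y j / ‖y‖ ^ (n + 1))

/-- The maximal Riesz transform `R_j^⋆ f(x) = sup_{ε > 0} |R_{j,ε} f(x)|`. -/
def rieszMax {n : ℕ} (j : Fin n) (f : Rn n → ℝ) (x : Rn n) : ℝ≥0∞ :=
  ⨆ (ε : ℝ) (_ : 0 < ε), (‖rieszTrunc j ε f x‖₊ : ℝ≥0∞)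


theorem coord_le_norm {n : ℕ} (u : Rn n) (i : Fin n) : |u i| ≤ ‖u‖ := by
  simpa using PiLp.norm_apply_le u i

theorem norm_le_of_coord {n : ℕ} (u : Rn n) (r : ℝ) (hr : 0 ≤ r) (h : ∀ i, |u i| ≤ r) :
    ‖u‖ ≤ n * r := by
  rw [EuclideanSpace.norm_eq]
  apply Real.sqrt_le_iff.2
  refine ⟨by positivity, ?_⟩
  calc ∑ i, ‖u i‖ ^ 2 ≤ ∑ i : Fin n, r ^ 2 := by
        apply Finset.sum_le_sum
        intro i _
        have := h i
        rw [← Real.norm_eq_abs] at this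
        gcongr
    _ = n * r ^ 2 := by simp
    _ ≤ (n * r) ^ 2 := by
        rw [mul_pow]
        gcongr
        rcases Nat.eq_zero_or_pos n with h | h
        · simp [h]
        · exact_mod_cast Nat.le_self_pow (by norm_num) n

theorem volume_cube {n : ℕ} (c : Rn n) (r : ℝ) (hr : 0 < r) :
    volume (Cube c r) = ENNReal.ofReal ((2 * r) ^ n) := by
  have h1 : Cube c r = (WithLp.ofLp : Rn n → (Fin n → ℝ)) ⁻¹'
      (Set.pi Set.univ fun i => Set.Icc (c i - r) (c i + r)) := by
    ext y
    simp only [Cube, Set.mem_ofPred_eq, Set.mem_preimage, Set.mem_pi, Set.mem_univ, true_imp_iff,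
      Set.mem_Icc, abs_le]
    refine forall_congr' fun i => ⟨fun h => ⟨by linarith [h.1], by linarith [h.2]⟩,
      fun h => ⟨by linarith [h.1], by linarith [h.2]⟩⟩
  rw [h1, (PiLp.volume_preserving_ofLp (Fin n)).measure_preimage
    (MeasurableSet.univ_pi fun i => measurableSet_Icc).nullMeasurableSet, volume_pi_pi]
  simp only [Real.volume_Icc]
  have h2 : ∀ i : Fin n, c i + r - (c i - r) = 2 * r := fun i => by ring
  simp only [h2]
  rw [Finset.prod_const, ENNReal.ofReal_pow (by positivity)]
  simp only [Finset.card_univ, Fintype.card_fin]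

/-- half-open cube -/
def HC {n : ℕ} (c : Rn n) (r : ℝ) : Set (Rn n) := {y | ∀ i, c i - r ≤ y i ∧ y i < c i + r}

theorem hc_eq {n : ℕ} (c : Rn n) (r : ℝ) : HC c r = (WithLp.ofLp : Rn n → (Fin n → ℝ)) ⁻¹'
      (Set.pi Set.univ fun i => Set.Ico (c i - r) (c i + r)) := by
  ext y
  simp only [HC, Set.mem_ofPred_eq, Set.mem_preimage, Set.mem_pi, Set.mem_univ, true_imp_iff,
      Set.mem_Ico]

theorem measurableSet_hc {n : ℕ} (c : Rn n) (r : ℝ) : MeasurableSet (HC c r) := by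
  rw [hc_eq]
  exact (PiLp.volume_preserving_ofLp (Fin n)).measurable
    (MeasurableSet.univ_pi fun i => measurableSet_Ico)

theorem volume_hc {n : ℕ} (c : Rn n) (r : ℝ) (hr : 0 < r) :
    volume (HC c r) = ENNReal.ofReal ((2 * r) ^ n) := by
  rw [hc_eq, (PiLp.volume_preserving_ofLp (Fin n)).measure_preimage
    (MeasurableSet.univ_pi fun i => measurableSet_Ico).nullMeasurableSet, volume_pi_pi]
  simp only [Real.volume_Ico]
  have h2 : ∀ i : Fin n, c i + r - (c i - r) = 2 * r := fun i => by ring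
  simp only [h2]
  rw [Finset.prod_const, ENNReal.ofReal_pow (by positivity)]
  simp only [Finset.card_univ, Fintype.card_fin]

theorem isClosed_cube {n : ℕ} (c : Rn n) (r : ℝ) : IsClosed (Cube c r) := by
  have : Cube c r = ⋂ i, {y : Rn n | |y i - c i| ≤ r} := by
    ext y; simp [Cube]
  rw [this]
  refine isClosed_iInter fun i => isClosed_le ?_ continuous_const
  fun_prop

theorem measurableSet_cube {n : ℕ} (c : Rn n) (r : ℝ) : MeasurableSet (Cube c r) :=
  (isClosed_cube c r).measurableSet

theorem hc_subset_cube {n : ℕ} (c : Rn n) (r : ℝ) : HC c r ⊆ Cube c r := by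
  intro y hy i
  have := hy i
  rw [abs_le]
  constructor <;> linarith

theorem cube_mono {n : ℕ} (c : Rn n) {r s : ℝ} (h : r ≤ s) : Cube c r ⊆ Cube c s :=
  fun _ hy i => (hy i).trans h

theorem cube_subset_ball {n : ℕ} (c : Rn n) (r : ℝ) (hr : 0 ≤ r) :
    Cube c r ⊆ Metric.closedBall c (n * r) := by
  intro y hy
  rw [Metric.mem_closedBall, dist_eq_norm]
  exact norm_le_of_coord _ _ hr (by simpa [Cube] using hy)

theorem isBounded_cube {n : ℕ} (c : Rn n) (r : ℝ) (hr : 0 ≤ r) : IsBounded (Cube c r) :=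
  Metric.isBounded_closedBall.subset (cube_subset_ball c r hr)

theorem ball_subset_cube {n : ℕ} (c : Rn n) (r : ℝ) :
    Metric.closedBall c r ⊆ Cube c r := by
  intro y hy i
  rw [Metric.mem_closedBall, dist_eq_norm] at hy
  exact (by simpa using coord_le_norm (y - c) i : |y i - c i| ≤ ‖y - c‖).trans hy

theorem le_maximal {n : ℕ} (f : Rn n → ℝ≥0∞) (x c : Rn n) (r : ℝ) (hr : 0 < r)
    (hx : x ∈ Cube c r) :
    (volume (Cube c r))⁻¹ * ∫⁻ y in Cube c r, f y ≤ maximal f x := by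
  unfold maximal
  exact le_iSup_of_le c (le_iSup_of_le r (le_iSup_of_le hr (le_iSup_of_le hx le_rfl)))

theorem vol_ne_zero {n : ℕ} (c : Rn n) (r : ℝ) (hr : 0 < r) : volume (Cube c r) ≠ 0 := by
  rw [volume_cube c r hr]
  simp only [ne_eq, ENNReal.ofReal_eq_zero, not_le]
  positivity

theorem vol_ne_top {n : ℕ} (c : Rn n) (r : ℝ) (hr : 0 < r) : volume (Cube c r) ≠ ⊤ := by
  rw [volume_cube c r hr]
  exact ENNReal.ofReal_ne_top

theorem int_cube_le {n : ℕ} (f : Rn n → ℝ≥0∞) (x c : Rn n) (r : ℝ) (hr : 0 < r)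
    (hx : x ∈ Cube c r) :
    ∫⁻ y in Cube c r, f y ≤ ENNReal.ofReal ((2 * r) ^ n) * maximal f x := by
  have := le_maximal f x c r hr hx
  rw [← volume_cube c r hr]
  rw [mul_comm, ← div_eq_mul_inv] at this
  rw [mul_comm]
  exact (ENNReal.div_le_iff (vol_ne_zero c r hr) (vol_ne_top c r hr)).1 this

theorem maximal_mono {n : ℕ} {f g : Rn n → ℝ≥0∞} (h : ∀ x, f x ≤ g x) (x : Rn n) :
    maximal f x ≤ maximal g x := by
  unfold maximal
  gcongr with c r hr hx
  exact h _

theorem maximal_le {n : ℕ} (f : Rn n → ℝ≥0∞) (x : Rn n) (B : ℝ≥0∞)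
    (h : ∀ c r, 0 < r → x ∈ Cube c r → ∫⁻ y in Cube c r, f y ≤ ENNReal.ofReal ((2 * r) ^ n) * B) :
    maximal f x ≤ B := by
  unfold maximal
  refine iSup_le fun c => iSup_le fun r => iSup_le fun hr => iSup_le fun hx => ?_
  have := h c r hr hx
  rw [← volume_cube c r hr] at this
  rw [mul_comm, ← div_eq_mul_inv]
  refine (ENNReal.div_le_iff (vol_ne_zero c r hr) (vol_ne_top c r hr)).2 ?_
  rwa [mul_comm]

theorem maximal_one_le {n : ℕ} (x : Rn n) : maximal (fun _ => 1) x ≤ 1 := by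
  apply maximal_le
  intro c r hr hx
  simp [volume_cube c r hr]

/-- tail kernel -/
def tk {n : ℕ} (c : Rn n) (r : ℝ) (z : Rn n) : ℝ := r / (r + ‖z - c‖) ^ (n + 1)

theorem tk_nonneg {n : ℕ} (c : Rn n) (r : ℝ) (hr : 0 < r) (z : Rn n) : 0 ≤ tk c r z := by
  unfold tk; positivity

theorem tk_cont {n : ℕ} (c : Rn n) (r : ℝ) (hr : 0 < r) : Continuous (tk c r) := by
  unfold tk
  refine Continuous.div (by fun_prop) (by fun_prop) ?_
  intro z; positivity

theorem tk_le_tsum {n : ℕ} (c : Rn n) (r : ℝ) (hr : 0 < r) (z : Rn n) :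
    ENNReal.ofReal (tk c r z) ≤ ∑' k : ℕ, (Cube c (2 ^ k * r)).indicator
      (fun _ => ENNReal.ofReal (2 ^ (n + 1) * (1 / 2) ^ k * ((2 ^ k * r) ^ n)⁻¹)) z := by
  classical
  have hex : ∃ k : ℕ, z ∈ Cube c (2 ^ k * r) := by
    obtain ⟨k, hk⟩ := pow_unbounded_of_one_lt (‖z - c‖ / r) (one_lt_two)
    refine ⟨k, ball_subset_cube _ _ ?_⟩
    rw [Metric.mem_closedBall, dist_eq_norm]
    rw [div_lt_iff₀ hr] at hk
    exact hk.le
  have hk := Nat.find_spec hex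
  have hmin := fun m => @Nat.find_min _ _ hex m
  set k := Nat.find hex
  refine le_trans ?_ (ENNReal.le_tsum k)
  rw [Set.indicator_of_mem hk]
  apply ENNReal.ofReal_le_ofReal
  unfold tk
  have hn := norm_nonneg (z - c)
  rcases Nat.eq_zero_or_pos k with h0 | h0
  · rw [h0]
    simp only [pow_zero, one_mul, mul_one]
    have h2 : (1 : ℝ) ≤ 2 ^ (n + 1) := one_le_pow₀ (by norm_num)
    calc r / (r + ‖z - c‖) ^ (n + 1) ≤ r / r ^ (n + 1) := by
          gcongr; linarith
      _ = (r ^ n)⁻¹ := by field_simp; ring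
      _ ≤ _ := le_mul_of_one_le_left (by positivity) h2
  · obtain ⟨m, hm⟩ : ∃ m, k = m + 1 := ⟨k - 1, by omega⟩
    have h3 := hmin m (by omega)
    have h4 : 2 ^ m * r < ‖z - c‖ := by
      by_contra h5
      push Not at h5
      exact h3 (ball_subset_cube _ _ (by rwa [Metric.mem_closedBall, dist_eq_norm]))
    rw [hm]
    calc r / (r + ‖z - c‖) ^ (n + 1) ≤ r / (2 ^ m * r) ^ (n + 1) := by
          gcongr; linarith
      _ = _ := by
          field_simp
          rw [pow_succ (2 : ℝ) m, one_div, inv_pow]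
          field_simp
          ring

theorem tail_le {n : ℕ} : ∃ C : ℝ≥0, ∀ (f : Rn n → ℝ≥0∞) (x c : Rn n) (r : ℝ), Measurable f →
    0 < r → x ∈ Cube c r →
    ∫⁻ z, ENNReal.ofReal (tk c r z) * f z ≤ C * maximal f x := by
  refine ⟨2 ^ (n + 1) * 2 ^ n * 2, ?_⟩
  intro f x c r hf hr hx
  calc ∫⁻ z, ENNReal.ofReal (tk c r z) * f z
      ≤ ∫⁻ z, ∑' k : ℕ, (Cube c (2 ^ k * r)).indicator
          (fun z => ENNReal.ofReal (2 ^ (n + 1) * (1 / 2) ^ k * ((2 ^ k * r) ^ n)⁻¹) * f z) z := by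
        apply lintegral_mono
        intro z
        dsimp only
        refine (mul_le_mul_left (tk_le_tsum c r hr z) _).trans (le_of_eq ?_)
        rw [← ENNReal.tsum_mul_right]
        congr 1
        ext k
        by_cases h : z ∈ Cube c (2 ^ k * r) <;> simp [h]
    _ = ∑' k : ℕ, ENNReal.ofReal (2 ^ (n + 1) * (1 / 2) ^ k * ((2 ^ k * r) ^ n)⁻¹) *
          ∫⁻ z in Cube c (2 ^ k * r), f z := by
        rw [lintegral_tsum]
        · congr 1
          ext k
          rw [lintegral_indicator (measurableSet_cube _ _), lintegral_const_mul _ hf]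
        · intro k
          exact ((hf.const_mul _).indicator (measurableSet_cube _ _)).aemeasurable
    _ ≤ ∑' k : ℕ, ENNReal.ofReal (2 ^ (n + 1) * 2 ^ n * (1 / 2) ^ k) * maximal f x := by
        apply ENNReal.tsum_le_tsum
        intro k
        have h1 : (1 : ℝ) ≤ 2 ^ k := one_le_pow₀ (by norm_num)
        have := int_cube_le f x c (2 ^ k * r) (by positivity)
          (cube_mono c (le_mul_of_one_le_left hr.le h1) hx)
        refine (mul_le_mul_right this _).trans (le_of_eq ?_)
        rw [← mul_assoc, ← ENNReal.ofReal_mul (by positivity)]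
        congr 2
        rw [mul_pow 2 (2 ^ k * r) n]
        field_simp
    _ = _ := by
        rw [ENNReal.tsum_mul_right]
        congr 1
        rw [← ENNReal.ofReal_tsum_of_nonneg]
        · rw [(hasSum_geometric_two.mul_left _).tsum_eq]
          rw [ENNReal.ofReal_eq_coe_nnreal (by positivity)]
          rfl
        · intro k; positivity
        · exact (summable_geometric_two).mul_left _


/-- Lipschitz-regularized Riesz kernel -/
def Ker {n : ℕ} (j : Fin n) (ε : ℝ) (u : Rn n) : ℝ := u j / (max ‖u‖ ε) ^ (n + 1)

theorem ker_abs_le {n : ℕ} (j : Fin n) (ε : ℝ) (hε : 0 < ε) (u : Rn n) :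
    |Ker j ε u| ≤ (ε ^ n)⁻¹ := by
  unfold Ker
  have h1 : 0 < max ‖u‖ ε := lt_max_of_lt_right hε
  rw [abs_div, abs_of_pos (pow_pos h1 _)]
  calc |u j| / max ‖u‖ ε ^ (n + 1) ≤ max ‖u‖ ε / max ‖u‖ ε ^ (n + 1) := by
        gcongr
        exact (coord_le_norm u j).trans (le_max_left _ _)
    _ = (max ‖u‖ ε ^ n)⁻¹ := by field_simp; ring
    _ ≤ (ε ^ n)⁻¹ := by
        gcongr
        exact le_max_right _ _

theorem ker_cont {n : ℕ} (j : Fin n) (ε : ℝ) (hε : 0 < ε) : Continuous (Ker j ε) := by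
  unfold Ker
  refine Continuous.div (by fun_prop) (by fun_prop) ?_
  intro z
  have h1 : 0 < max ‖z‖ ε := lt_max_of_lt_right hε
  positivity

theorem ker_lip_aux (p : ℕ) (a b A B d : ℝ) (hA : 0 < A) (hB : 0 < B)
    (hb : |b| ≤ B) (hd : |a - b| ≤ d) (hAB : |A - B| ≤ d) (m : ℝ) (hm : 0 < m) (hmA : m ≤ A)
    (hmB : m ≤ B) : |a / A ^ p - b / B ^ p| ≤ (p + 1) * d / m ^ p := by
  have hd0 : 0 ≤ d := (abs_nonneg _).trans hd
  have e : a / A ^ p - b / B ^ p = (a - b) / A ^ p + b * (B ^ p - A ^ p) / (A ^ p * B ^ p) := by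
    field_simp
    ring
  rw [e]
  have h1 : |(a - b) / A ^ p| ≤ d / m ^ p := by
    rw [abs_div, abs_of_pos (pow_pos hA p)]
    gcongr
  have h2 : |b * (B ^ p - A ^ p) / (A ^ p * B ^ p)| ≤ p * d / m ^ p := by
    rcases Nat.eq_zero_or_pos p with hp | hp
    · simp [hp]
    obtain ⟨q, rfl⟩ : ∃ q, p = q + 1 := ⟨p - 1, by omega⟩
    have h3 := abs_pow_sub_pow_le B A (q + 1)
    rw [abs_of_pos hA, abs_of_pos hB, abs_sub_comm, Nat.add_sub_cancel] at h3
    rw [abs_div, abs_mul, abs_of_pos (mul_pos (pow_pos hA _) (pow_pos hB _))]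
    have h4 : |b| * |B ^ (q+1) - A ^ (q+1)| ≤ B * (d * ((q + 1 : ℕ) : ℝ) * max B A ^ q) := by
      rw [abs_sub_comm]
      gcongr
      refine h3.trans ?_
      rw [abs_sub_comm]
      gcongr
    refine (div_le_div_of_nonneg_right h4 (by positivity)).trans ?_
    rcases le_total A B with h | h
    · rw [max_eq_left h]
      calc B * (d * ((q + 1 : ℕ) : ℝ) * B ^ q) / (A ^ (q+1) * B ^ (q+1))
          = ((q + 1 : ℕ) : ℝ) * d / A ^ (q+1) := by field_simp; ring
        _ ≤ _ := by gcongr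
    · rw [max_eq_right h]
      calc B * (d * ((q + 1 : ℕ) : ℝ) * A ^ q) / (A ^ (q+1) * B ^ (q+1))
          = ((q + 1 : ℕ) : ℝ) * d / (A * B ^ q) := by field_simp; ring
        _ ≤ ((q + 1 : ℕ) : ℝ) * d / (m * m ^ q) := by gcongr
        _ = _ := by rw [pow_succ']
  calc _ ≤ d / m ^ p + p * d / m ^ p := (abs_add_le _ _).trans (add_le_add h1 h2)
    _ = _ := by ring

theorem ker_lip {n : ℕ} (j : Fin n) (ε : ℝ) (u v : Rn n) (m : ℝ) (hm : 0 < m)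
    (hu : m ≤ max ‖u‖ ε) (hv : m ≤ max ‖v‖ ε) :
    |Ker j ε u - Ker j ε v| ≤ (n + 2) * ‖u - v‖ / m ^ (n + 1) := by
  unfold Ker
  have := ker_lip_aux (n + 1) (u j) (v j) (max ‖u‖ ε) (max ‖v‖ ε) ‖u - v‖ (hm.trans_le hu)
    (hm.trans_le hv) ((coord_le_norm v j).trans (le_max_left _ _))
    (by simpa using coord_le_norm (u - v) j)
    ((abs_max_sub_max_le_abs _ _ _).trans (abs_norm_sub_norm_le _ _)) m hm hu hv
  push_cast at this
  convert this using 2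
  ring

/-- regularized truncation -/
def TT {n : ℕ} (j : Fin n) (ε : ℝ) (f : Rn n → ℝ) (x : Rn n) : ℝ := ∫ z, Ker j ε (x - z) * f z

/-- regularized maximal operator -/
def TS {n : ℕ} (j : Fin n) (f : Rn n → ℝ) (x : Rn n) : ℝ≥0∞ :=
  ⨆ (ε : ℝ) (_ : 0 < ε), ‖TT j ε f x‖ₑ

theorem le_TS {n : ℕ} (j : Fin n) (ε : ℝ) (hε : 0 < ε) (f : Rn n → ℝ) (x : Rn n) :
    ‖TT j ε f x‖ₑ ≤ TS j f x := le_iSup₂_of_le ε hε le_rfl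

theorem TS_le {n : ℕ} (j : Fin n) (f : Rn n → ℝ) (x : Rn n) (B : ℝ≥0∞)
    (h : ∀ ε, 0 < ε → ‖TT j ε f x‖ₑ ≤ B) : TS j f x ≤ B := iSup₂_le h

/-- all regularized integrals converge -/
def Good {n : ℕ} (j : Fin n) (f : Rn n → ℝ) : Prop :=
  ∀ ε, 0 < ε → ∀ x, Integrable (fun z => Ker j ε (x - z) * f z)

theorem good_of_integrable {n : ℕ} (j : Fin n) (f : Rn n → ℝ) (hf : Integrable f) : Good j f := by
  intro ε hε x
  refine hf.bdd_mul (c := (ε ^ n)⁻¹) ?_ ?_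
  · exact ((ker_cont j ε hε).comp (by fun_prop)).aestronglyMeasurable
  · exact Eventually.of_forall fun z => ker_abs_le j ε hε _

theorem TT_add {n : ℕ} (j : Fin n) (ε : ℝ) (hε : 0 < ε) (f g : Rn n → ℝ) (hf : Good j f)
    (hg : Good j g) (x : Rn n) : TT j ε (fun z => f z + g z) x = TT j ε f x + TT j ε g x := by
  unfold TT
  simp only [mul_add]
  exact integral_add (hf ε hε x) (hg ε hε x)

theorem TT_congr {n : ℕ} (j : Fin n) (ε : ℝ) (f g : Rn n → ℝ) (h : f =ᵐ[volume] g) (x : Rn n) :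
    TT j ε f x = TT j ε g x := by
  unfold TT
  refine integral_congr_ae ?_
  filter_upwards [h] with z hz
  rw [hz]

theorem TS_congr {n : ℕ} (j : Fin n) (f g : Rn n → ℝ) (h : f =ᵐ[volume] g) :
    TS j f = TS j g := by
  funext x
  unfold TS
  simp only [TT_congr j _ f g h]

theorem TS_add_le {n : ℕ} (j : Fin n) (f g : Rn n → ℝ) (hf : Good j f)
    (hg : Good j g) (x : Rn n) : TS j (fun z => f z + g z) x ≤ TS j f x + TS j g x := by
  apply TS_le
  intro ε hε
  rw [TT_add j ε hε f g hf hg]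
  exact (enorm_add_le _ _).trans (add_le_add (le_TS j ε hε f x) (le_TS j ε hε g x))

theorem TT_cont {n : ℕ} (j : Fin n) (ε : ℝ) (hε : 0 < ε) (f : Rn n → ℝ) (hf : Integrable f) :
    Continuous (TT j ε f) := by
  unfold TT
  refine continuous_of_dominated (bound := fun z => (ε ^ n)⁻¹ * ‖f z‖) ?_ ?_ ?_ ?_
  · intro x
    exact (good_of_integrable j f hf ε hε x).aestronglyMeasurable
  · intro x
    refine Eventually.of_forall fun z => ?_
    rw [norm_mul]
    gcongr
    exact ker_abs_le j ε hε _
  · exact hf.norm.const_mul _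
  · refine Eventually.of_forall fun z => ?_
    exact ((ker_cont j ε hε).comp (by fun_prop)).mul continuous_const

theorem TS_meas {n : ℕ} (j : Fin n) (f : Rn n → ℝ) (hf : Integrable f) :
    Measurable (TS j f) := by
  have : LowerSemicontinuous (TS j f) := by
    unfold TS
    apply lowerSemicontinuous_biSup
    intro ε hε
    exact ((TT_cont j ε hε f hf).enorm).lowerSemicontinuous
  exact this.measurable

theorem integral_trunc_eq {n : ℕ} (j : Fin n) (ε : ℝ) (f : Rn n → ℝ) (x : Rn n) :
    rieszTrunc j ε f x = rieszConst n *
      ∫ z in {z : Rn n | ε < ‖x - z‖}, Ker j ε (x - z) * f z := by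
  unfold rieszTrunc
  congr 1
  have hS : MeasurableSet {y : Rn n | ε < ‖y‖} := measurableSet_lt measurable_const (by fun_prop)
  have hS' : MeasurableSet {z : Rn n | ε < ‖x - z‖} :=
    measurableSet_lt measurable_const (by fun_prop)
  rw [← integral_indicator hS, ← integral_indicator hS']
  rw [← integral_sub_left_eq_self _ volume x]
  congr 1
  ext z
  by_cases h : ε < ‖x - z‖
  · rw [Set.indicator_of_mem (by exact h), Set.indicator_of_mem (by exact h)]
    have e : x - (x - z) = z := by abel
    simp only [Ker, max_eq_left h.le, e]
    ring
  · rw [Set.indicator_of_notMem (by exact h), Set.indicator_of_notMem (by exact h)]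

theorem rieszConst_pos (n : ℕ) : 0 < rieszConst n := by
  unfold rieszConst
  have := Real.Gamma_pos_of_pos (s := ((n : ℝ) + 1) / 2) (by positivity)
  have := Real.pi_pos
  positivity

theorem inner_part_le {n : ℕ} (j : Fin n) (ε : ℝ) (hε : 0 < ε) (f : Rn n → ℝ) (x : Rn n) :
    ‖∫ z in {z : Rn n | ε < ‖x - z‖}ᶜ, Ker j ε (x - z) * f z‖ₑ ≤ 2 ^ n * maximalR f x := by
  refine (enorm_integral_le_lintegral_enorm _).trans ?_
  calc ∫⁻ z in {z : Rn n | ε < ‖x - z‖}ᶜ, ‖Ker j ε (x - z) * f z‖ₑ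
      ≤ ∫⁻ z in Cube x ε, ‖Ker j ε (x - z) * f z‖ₑ := by
        apply lintegral_mono_set
        intro z hz
        apply ball_subset_cube
        simp only [Set.mem_compl_iff, Set.mem_ofPred_eq, not_lt] at hz
        rwa [Metric.mem_closedBall, dist_comm, dist_eq_norm]
    _ ≤ ∫⁻ z in Cube x ε, ENNReal.ofReal ((ε ^ n)⁻¹) * ‖f z‖ₑ := by
        apply lintegral_mono
        intro z
        dsimp only
        rw [enorm_mul]
        gcongr
        rw [Real.enorm_eq_ofReal_abs]
        exact ENNReal.ofReal_le_ofReal (ker_abs_le j ε hε _)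
    _ = ENNReal.ofReal ((ε ^ n)⁻¹) * ∫⁻ z in Cube x ε, ‖f z‖ₑ := by
        rw [lintegral_const_mul' _ _ ENNReal.ofReal_ne_top]
    _ ≤ ENNReal.ofReal ((ε ^ n)⁻¹) * (ENNReal.ofReal ((2 * ε) ^ n) * maximalR f x) := by
        gcongr
        apply int_cube_le _ _ _ _ hε
        intro i
        simp [hε.le]
    _ = _ := by
        rw [← mul_assoc, ← ENNReal.ofReal_mul (by positivity)]
        congr 1
        rw [mul_pow]
        rw [show (ε ^ n)⁻¹ * (2 ^ n * ε ^ n) = (2 : ℝ) ^ n by field_simp]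
        rw [ENNReal.ofReal_pow (by norm_num)]
        simp

theorem TT_split {n : ℕ} (j : Fin n) (ε : ℝ) (hε : 0 < ε) (f : Rn n → ℝ) (hf : Good j f)
    (x : Rn n) : TT j ε f x = (∫ z in {z : Rn n | ε < ‖x - z‖}, Ker j ε (x - z) * f z) +
      ∫ z in {z : Rn n | ε < ‖x - z‖}ᶜ, Ker j ε (x - z) * f z := by
  have hS' : MeasurableSet {z : Rn n | ε < ‖x - z‖} :=
    measurableSet_lt measurable_const (by fun_prop)
  rw [integral_add_compl hS' (hf ε hε x)]
  rfl

theorem rieszMax_le {n : ℕ} (j : Fin n) (f : Rn n → ℝ) (hf : Good j f) (x : Rn n) :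
    rieszMax j f x ≤ (rieszConst n).toNNReal * (TS j f x + 2 ^ n * maximalR f x) := by
  unfold rieszMax
  refine iSup₂_le fun ε hε => ?_
  change ‖rieszTrunc j ε f x‖ₑ ≤ _
  rw [integral_trunc_eq, enorm_mul, Real.enorm_eq_ofReal_abs (rieszConst n),
    abs_of_pos (rieszConst_pos n)]
  change ENNReal.ofReal _ * _ ≤ ENNReal.ofReal _ * _
  gcongr
  have h1 := TT_split j ε hε f hf x
  rw [eq_comm, ← eq_sub_iff_add_eq] at h1
  rw [h1]
  refine (enorm_sub_le).trans ?_
  exact add_le_add (le_TS j ε hε f x) (inner_part_le j ε hε f x)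

theorem TS_le_rieszMax {n : ℕ} (j : Fin n) (f : Rn n → ℝ) (hf : Good j f) (x : Rn n) :
    TS j f x ≤ ((rieszConst n)⁻¹).toNNReal * rieszMax j f x + 2 ^ n * maximalR f x := by
  apply TS_le
  intro ε hε
  rw [TT_split j ε hε f hf x]
  refine (enorm_add_le _ _).trans (add_le_add ?_ (inner_part_le j ε hε f x))
  have h2 : ‖rieszTrunc j ε f x‖ₑ ≤ rieszMax j f x := by
    unfold rieszMax
    exact le_iSup₂_of_le ε hε le_rfl
  have h3 := integral_trunc_eq j ε f x
  have h4 := rieszConst_pos n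
  rw [show (∫ z in {z : Rn n | ε < ‖x - z‖}, Ker j ε (x - z) * f z) =
    (rieszConst n)⁻¹ * rieszTrunc j ε f x by rw [h3]; field_simp]
  rw [enorm_mul, Real.enorm_eq_ofReal_abs (rieszConst n)⁻¹, abs_of_pos (by positivity)]
  change ENNReal.ofReal _ * _ ≤ ENNReal.ofReal _ * _
  gcongr

theorem ker_diff_le {n : ℕ} (j : Fin n) (ε ε0 : ℝ) (hε : 0 < ε) (hε0 : 0 < ε0) (x x0 : Rn n) :
    ∃ C, ∀ z, |Ker j ε (x - z) - {z : Rn n | ε0 < ‖x0 - z‖}.indicator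
      (fun z => Ker j ε0 (x0 - z)) z| ≤ C * tk 0 1 z := by
  set R := 2 * ‖x‖ + 2 * ‖x0‖ + 2 * ε + 2 * ε0 + 2 with hR
  have hx := norm_nonneg x
  have hx0 := norm_nonneg x0
  refine ⟨((ε ^ n)⁻¹ + (ε0 ^ n)⁻¹) * (1 + R) ^ (n + 1) + (n + 2) * ‖x - x0‖ * 4 ^ (n + 1), ?_⟩
  intro z
  have hz := norm_nonneg z
  have htk : tk 0 1 z = 1 / (1 + ‖z‖) ^ (n + 1) := by simp [tk]
  rw [htk, add_mul]
  by_cases h : ‖z‖ ≤ R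
  · refine le_trans ?_ (le_add_of_nonneg_right (by positivity))
    have h1 : 1 ≤ (1 + R) ^ (n + 1) * (1 / (1 + ‖z‖) ^ (n + 1)) := by
      rw [mul_one_div, one_le_div (by positivity)]
      gcongr
    rw [mul_assoc]
    refine le_trans ?_ (le_mul_of_one_le_right (by positivity) h1)
    refine (abs_sub _ _).trans (add_le_add (ker_abs_le j ε hε _) ?_)
    by_cases h2 : ε0 < ‖x0 - z‖
    · rw [Set.indicator_of_mem (by exact h2)]
      exact ker_abs_le j ε0 hε0 _
    · rw [Set.indicator_of_notMem (by exact h2)]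
      simp only [abs_zero]
      positivity
  · push Not at h
    refine le_trans ?_ (le_add_of_nonneg_left (by positivity))
    have h1 : ‖z‖ - ‖x‖ ≤ ‖x - z‖ := by
      rw [norm_sub_rev]; exact norm_sub_norm_le z x
    have h2 : ‖z‖ - ‖x0‖ ≤ ‖x0 - z‖ := by
      rw [norm_sub_rev]; exact norm_sub_norm_le z x0
    rw [Set.indicator_of_mem (by change ε0 < _; linarith)]
    have h3 : Ker j ε0 (x0 - z) = Ker j ε (x0 - z) := by
      unfold Ker
      rw [max_eq_left (by linarith), max_eq_left (by linarith)]
    rw [h3]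
    refine (ker_lip j ε (x - z) (x0 - z) ((1 + ‖z‖) / 4) (by positivity)
      (le_max_of_le_left (by linarith)) (le_max_of_le_left (by linarith))).trans (le_of_eq ?_)
    rw [sub_sub_sub_cancel_right, div_pow]
    field_simp

theorem good_or {n : ℕ} (j : Fin n) (f : Rn n → ℝ) (hf : Measurable f)
    (hw : ∫⁻ z, ENNReal.ofReal (tk 0 1 z) * ‖f z‖ₑ < ⊤) :
    Good j f ∨ ∀ x, rieszMax j f x = 0 := by
  by_cases h : ∃ ε0, 0 < ε0 ∧ ∃ x0, IntegrableOn (fun z => Ker j ε0 (x0 - z) * f z)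
      {z : Rn n | ε0 < ‖x0 - z‖}
  · left
    obtain ⟨ε0, hε0, x0, h0⟩ := h
    intro ε hε x
    have hS' : MeasurableSet {z : Rn n | ε0 < ‖x0 - z‖} :=
      measurableSet_lt measurable_const (by fun_prop)
    rw [← integrable_indicator_iff hS'] at h0
    obtain ⟨C, hC⟩ := ker_diff_le j ε ε0 hε hε0 x x0
    have hW : Integrable (fun z => tk 0 1 z * f z) := by
      refine ⟨((tk_cont 0 1 one_pos).measurable.mul hf).aestronglyMeasurable, ?_⟩
      rw [hasFiniteIntegral_iff_enorm]
      convert hw using 3 with z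
      rw [enorm_mul, Real.enorm_eq_ofReal (tk_nonneg _ _ one_pos _)]
    have hm1 : Measurable fun z => Ker j ε (x - z) :=
      ((ker_cont j ε hε).comp (by fun_prop)).measurable
    have hm2 : Measurable fun z => {z : Rn n | ε0 < ‖x0 - z‖}.indicator
      (fun z => Ker j ε0 (x0 - z)) z :=
      (((ker_cont j ε0 hε0).comp (by fun_prop)).measurable).indicator hS'
    have hD : Integrable (fun z => (Ker j ε (x - z) - {z : Rn n | ε0 < ‖x0 - z‖}.indicator
      (fun z => Ker j ε0 (x0 - z)) z) * f z) := by
      refine (hW.norm.const_mul C).mono' ((hm1.sub hm2).mul hf).aestronglyMeasurable ?_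
      refine Eventually.of_forall fun z => ?_
      rw [norm_mul, norm_mul, ← mul_assoc, Real.norm_of_nonneg (tk_nonneg _ _ one_pos _)]
      gcongr
      exact hC z
    refine (h0.add hD).congr (Eventually.of_forall fun z => ?_)
    simp only [Pi.add_apply]
    by_cases h2 : z ∈ {z : Rn n | ε0 < ‖x0 - z‖}
    · simp only [Set.indicator_of_mem h2]; ring
    · simp only [Set.indicator_of_notMem h2]; ring
  · right
    push Not at h
    intro x
    unfold rieszMax
    simp only [ENNReal.iSup_eq_zero]
    intro ε hε
    rw [integral_trunc_eq, integral_undef (h ε hε x)]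
    simp


theorem maximal_ind {n : ℕ} : ∃ C : ℝ≥0, ∀ x : Rn n,
    maximal ((Cube (0 : Rn n) 1).indicator 1) x ≤ C * ENNReal.ofReal (1 / (1 + ‖x‖ ^ n)) := by
  refine ⟨2 ^ n + (4 * n) ^ n + 1, fun x => ?_⟩
  apply maximal_le
  intro c s hs hx
  rw [lintegral_indicator_one (measurableSet_cube _ _), Measure.restrict_apply
    (measurableSet_cube _ _)]
  rcases Set.eq_empty_or_nonempty (Cube (0 : Rn n) 1 ∩ Cube c s) with h | ⟨p, hp1, hp2⟩
  · rw [h]; simp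
  have hxn : ‖x‖ ≤ n * (1 + 2 * s) := by
    apply norm_le_of_coord _ _ (by positivity)
    intro i
    have h1 := abs_le.1 (hx i)
    have h2 := abs_le.1 (hp1 i)
    have h3 := abs_le.1 (hp2 i)
    simp only [PiLp.zero_apply] at h2
    rw [abs_le]
    constructor <;> linarith [h1.1, h1.2, h2.1, h2.2, h3.1, h3.2]
  have hv1 : volume (Cube (0 : Rn n) 1 ∩ Cube c s) ≤ ENNReal.ofReal (2 ^ n) := by
    refine (measure_mono Set.inter_subset_left).trans ?_
    rw [volume_cube _ _ one_pos, mul_one]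
  have hv2 : volume (Cube (0 : Rn n) 1 ∩ Cube c s) ≤ ENNReal.ofReal ((2 * s) ^ n) := by
    refine (measure_mono Set.inter_subset_right).trans ?_
    rw [volume_cube _ _ hs]
  have hcoe : ((2 ^ n + (4 * n) ^ n + 1 : ℝ≥0) : ℝ≥0∞) =
      ENNReal.ofReal (2 ^ n + (4 * n) ^ n + 1) := by
    rw [ENNReal.ofReal_eq_coe_nnreal (by positivity)]
    rfl
  rw [hcoe, ← ENNReal.ofReal_mul (by positivity), ← ENNReal.ofReal_mul (by positivity)]
  rcases le_total (2 * s) 1 with h | h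
  · refine hv2.trans (ENNReal.ofReal_le_ofReal ?_)
    refine le_mul_of_one_le_right (by positivity) ?_
    rw [mul_one_div, one_le_div (by positivity)]
    have : ‖x‖ ^ n ≤ (4 * n) ^ n := by
      gcongr
      refine hxn.trans ?_
      nlinarith [(Nat.cast_nonneg n : (0 : ℝ) ≤ n)]
    have h2 : (0 : ℝ) ≤ 2 ^ n := by positivity
    linarith
  · refine hv1.trans (ENNReal.ofReal_le_ofReal ?_)
    rw [← mul_assoc, mul_one_div, le_div_iff₀ (by positivity)]
    have h3 : ‖x‖ ^ n ≤ (2 * n) ^ n * (2 * s) ^ n := by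
      rw [← mul_pow]
      gcongr
      refine hxn.trans ?_
      nlinarith [(Nat.cast_nonneg n : (0 : ℝ) ≤ n)]
    have h4 : (1 : ℝ) ≤ (2 * s) ^ n := one_le_pow₀ h
    have h5 : (2 : ℝ) ^ n * ((2 * n) ^ n * (2 * s) ^ n) = (4 * n) ^ n * (2 * s) ^ n := by
      rw [← mul_pow, ← mul_pow, ← mul_pow]; ring_nf
    have h6 : (0 : ℝ) < 2 ^ n := by positivity
    have h7 := mul_le_mul_of_nonneg_left h3 h6.le
    have h8 := mul_le_mul_of_nonneg_left h4 h6.le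
    nlinarith

theorem integrable_of_bdd {n : ℕ} (b : Rn n → ℝ) (c : Rn n) (r A : ℝ) (hr : 0 < r)
    (hb : Measurable b) (hA : ∀ᵐ z, |b z| ≤ A) (hs : ∀ z, z ∉ Cube c r → b z = 0) :
    Integrable b := by
  have h1 : b = (Cube c r).indicator b := by
    ext z
    by_cases h : z ∈ Cube c r
    · simp [h]
    · simp [h, hs z h]
  rw [h1, integrable_indicator_iff (measurableSet_cube _ _)]
  refine Measure.integrableOn_of_bounded (M := A) (vol_ne_top c r hr) hb.aestronglyMeasurable ?_
  exact ae_restrict_of_ae hA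

theorem local_unit {n : ℕ} (X : BFSNorm n) (j : Fin n)
    (hφ : X.ρ (fun x => ENNReal.ofReal (1 / (1 + ‖x‖ ^ n))) < ⊤)
    (hCF : ∃ C : ℝ≥0, 0 < C ∧ ∀ f : Rn n → ℝ, Measurable f →
      X.ρ (rieszMax j f) ≤ (C : ℝ≥0∞) * X.ρ (maximalR f)) (Λ : ℝ) (hΛ : 0 ≤ Λ) :
    ∃ C : ℝ≥0, ∀ b : Rn n → ℝ, Measurable b → (∀ z, |b z| ≤ 1) →
      (∀ z, z ∉ Cube 0 1 → b z = 0) → ∫⁻ z in Cube 0 Λ, TS j b z ≤ C := by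
  obtain ⟨C1, -, hC1⟩ := hCF
  obtain ⟨cE, hcE⟩ := X.int_le (Cube 0 Λ) (measurableSet_cube _ _) (isBounded_cube _ _ hΛ)
  obtain ⟨C2, hC2⟩ := maximal_ind (n := n)
  set Φ := X.ρ (fun x => ENNReal.ofReal (1 / (1 + ‖x‖ ^ n))) with hΦ
  set k : ℝ≥0 := ((rieszConst n)⁻¹).toNNReal
  lift Φ to ℝ≥0 using hφ.ne with Φ' hΦ'
  refine ⟨cE * ((k * C1 + 2 ^ n) * (C2 * Φ')), ?_⟩
  intro b hb h1 h0
  have hint : Integrable b := integrable_of_bdd b 0 1 1 one_pos hb (Eventually.of_forall h1) h0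
  have hM : X.ρ (maximalR b) ≤ C2 * Φ' := by
    calc X.ρ (maximalR b) ≤ X.ρ (fun x => C2 * ENNReal.ofReal (1 / (1 + ‖x‖ ^ n))) := by
          apply X.mono
          refine Eventually.of_forall fun x => ?_
          refine le_trans ?_ (hC2 x)
          refine maximal_mono (fun z => ?_) x
          by_cases h : z ∈ Cube (0 : Rn n) 1
          · rw [Set.indicator_of_mem h]
            have := h1 z
            rw [← Real.norm_eq_abs] at this
            simp only [Pi.one_apply]
            exact_mod_cast this
          · simp [h, h0 z h]
      _ = _ := by rw [X.smul, hΦ']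
  calc ∫⁻ z in Cube 0 Λ, TS j b z ≤ cE * X.ρ (TS j b) := hcE _ (TS_meas j b hint)
    _ ≤ cE * ((k * C1 + 2 ^ n) * (C2 * Φ')) := by
        gcongr
        calc X.ρ (TS j b) ≤ X.ρ (fun x => (k : ℝ≥0∞) * rieszMax j b x +
              ((2 ^ n : ℝ≥0) : ℝ≥0∞) * maximalR b x) := by
              apply X.mono
              refine Eventually.of_forall fun x => ?_
              have := TS_le_rieszMax j b (good_of_integrable j b hint) x
              push_cast
              exact this
          _ ≤ k * X.ρ (rieszMax j b) + ((2 ^ n : ℝ≥0) : ℝ≥0∞) * X.ρ (maximalR b) := by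
              refine (X.add_le _ _).trans ?_
              rw [X.smul, X.smul]
          _ ≤ k * (C1 * X.ρ (maximalR b)) + ((2 ^ n : ℝ≥0) : ℝ≥0∞) * X.ρ (maximalR b) := by
              gcongr
              exact hC1 b hb
          _ = (k * C1 + 2 ^ n) * X.ρ (maximalR b) := by push_cast; ring
          _ ≤ _ := by gcongr
    _ = _ := by push_cast; ring

theorem TT_smul {n : ℕ} (j : Fin n) (ε k : ℝ) (f : Rn n → ℝ) (x : Rn n) :
    TT j ε (fun z => k * f z) x = k * TT j ε f x := by
  unfold TT
  rw [← integral_const_mul]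
  congr 1
  ext z
  ring

theorem TT_scale {n : ℕ} (j : Fin n) (ε r : ℝ) (hr : 0 < r) (c : Rn n)
    (f : Rn n → ℝ) (x : Rn n) :
    TT j (r * ε) f (c + r • x) = TT j ε (fun z => f (c + r • z)) x := by
  unfold TT
  have h1 : ∀ z, Ker j ε (x - z) * f (c + r • z) =
      r ^ n * (Ker j (r * ε) (c + r • x - (c + r • z)) * f (c + r • z)) := by
    intro z
    have h2 : c + r • x - (c + r • z) = r • (x - z) := by
      rw [smul_sub]; abel
    rw [h2]
    have h3 : max ‖r • (x - z)‖ (r * ε) = r * max ‖x - z‖ ε := by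
      rw [norm_smul, Real.norm_of_nonneg hr.le, mul_max_of_nonneg _ _ hr.le]
    unfold Ker
    rw [h3, mul_pow, PiLp.smul_apply, smul_eq_mul]
    rw [← mul_assoc]
    congr 1
    rw [pow_succ r n]
    have : r ^ n * r * (max ‖x - z‖ ε) ^ (n + 1) = r * r ^ n * (max ‖x - z‖ ε) ^ (n + 1) := by ring
    rw [this, mul_assoc, mul_div_mul_left _ _ hr.ne', ← mul_div_assoc,
      mul_div_mul_left _ _ (pow_pos hr n).ne']
  simp only [h1]
  rw [integral_const_mul]
  have h4 := Measure.integral_comp_smul (μ := (volume : Measure (Rn n)))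
    (fun w => Ker j (r * ε) (c + r • x - (c + w)) * f (c + w)) r
  rw [h4]
  have h5 := integral_add_left_eq_self (μ := (volume : Measure (Rn n)))
    (fun w => Ker j (r * ε) (c + r • x - w) * f w) c
  rw [h5]
  simp only [finrank_euclideanSpace, Fintype.card_fin, smul_eq_mul]
  rw [abs_of_pos (by positivity)]
  field_simp

theorem TS_scale_le {n : ℕ} (j : Fin n) (r A : ℝ) (hr : 0 < r) (hA : 0 < A) (c : Rn n)
    (f : Rn n → ℝ) (x : Rn n) :
    TS j f (c + r • x) ≤ ENNReal.ofReal A * TS j (fun z => A⁻¹ * f (c + r • z)) x := by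
  apply TS_le
  intro ε hε
  have h1 := TT_scale j (ε / r) r hr c f x
  rw [mul_div_cancel₀ _ hr.ne'] at h1
  have h2 := TT_smul j (ε / r) A⁻¹ (fun z => f (c + r • z)) x
  have h3 : TT j ε f (c + r • x) = A * TT j (ε / r) (fun z => A⁻¹ * f (c + r • z)) x := by
    rw [h2, h1]; field_simp
  rw [h3, enorm_mul, Real.enorm_eq_ofReal hA.le]
  gcongr
  exact le_TS j (ε / r) (by positivity) _ x

theorem lintegral_scale {n : ℕ} (r : ℝ) (hr : 0 < r) (c : Rn n) (G : Rn n → ℝ≥0∞)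
    (hG : Measurable G) :
    ∫⁻ w, G w = ENNReal.ofReal (r ^ n) * ∫⁻ x, G (c + r • x) := by
  have h1 : ∫⁻ x, G (c + r • x) = ∫⁻ w, G (c + w) ∂(Measure.map (r • ·) volume) := by
    exact (lintegral_map (f := fun w => G (c + w)) (g := fun x => r • x)
      (hG.comp (by fun_prop)) (by fun_prop)).symm
  rw [h1, Measure.map_addHaar_smul _ hr.ne', lintegral_smul_measure, lintegral_add_left_eq_self]
  simp only [finrank_euclideanSpace, Fintype.card_fin, smul_eq_mul]
  rw [abs_of_pos (by positivity), ← mul_assoc, ← ENNReal.ofReal_mul (by positivity),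
    mul_inv_cancel₀ (by positivity)]
  simp

theorem mem_cube_scale {n : ℕ} (c x : Rn n) (r s : ℝ) (hr : 0 < r) :
    c + r • x ∈ Cube c (s * r) ↔ x ∈ Cube 0 s := by
  simp only [Cube, Set.mem_ofPred_eq, PiLp.add_apply, PiLp.smul_apply, smul_eq_mul,
    add_sub_cancel_left, PiLp.zero_apply, sub_zero, abs_mul, abs_of_pos hr]
  refine forall_congr' fun i => ?_
  rw [mul_comm s r, mul_le_mul_iff_right₀ hr]

/-- local bound at all scales -/
def LocalBd {n : ℕ} (j : Fin n) (Λ : ℝ) (C : ℝ≥0) : Prop :=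
  ∀ (c : Rn n) (r A : ℝ) (b : Rn n → ℝ), 0 < r → 0 < A → Measurable b → (∀ᵐ z, |b z| ≤ A) →
      (∀ z, z ∉ Cube c r → b z = 0) →
      ∫⁻ z in Cube c (Λ * r), TS j b z ≤ C * ENNReal.ofReal (A * r ^ n)

theorem local_scaled {n : ℕ} (X : BFSNorm n) (j : Fin n)
    (hφ : X.ρ (fun x => ENNReal.ofReal (1 / (1 + ‖x‖ ^ n))) < ⊤)
    (hCF : ∃ C : ℝ≥0, 0 < C ∧ ∀ f : Rn n → ℝ, Measurable f →
      X.ρ (rieszMax j f) ≤ (C : ℝ≥0∞) * X.ρ (maximalR f)) (Λ : ℝ) (hΛ : 0 ≤ Λ) :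
    ∃ C : ℝ≥0, LocalBd j Λ C := by
  obtain ⟨C, hC⟩ := local_unit X j hφ hCF Λ hΛ
  refine ⟨C, ?_⟩
  intro c r A b' hr hA hb' hbA' hb0'
  obtain ⟨b, hbb, hb, hbA, hb0⟩ : ∃ b : Rn n → ℝ, b' =ᵐ[volume] b ∧ Measurable b ∧
      (∀ z, |b z| ≤ A) ∧ (∀ z, z ∉ Cube c r → b z = 0) := by
    have hm : MeasurableSet {z | |b' z| ≤ A} := measurableSet_le (by fun_prop) measurable_const
    refine ⟨{z | |b' z| ≤ A}.indicator b', ?_, hb'.indicator hm, ?_, ?_⟩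
    · filter_upwards [hbA'] with z hz
      rw [Set.indicator_of_mem (by exact hz)]
    · intro z
      by_cases h : z ∈ {z | |b' z| ≤ A}
      · rw [Set.indicator_of_mem h]; exact h
      · rw [Set.indicator_of_notMem h]; simpa using hA.le
    · intro z hz
      by_cases h : z ∈ {z | |b' z| ≤ A}
      · rw [Set.indicator_of_mem h]; exact hb0' z hz
      · rw [Set.indicator_of_notMem h]
  rw [TS_congr j b' b hbb]
  have hint : Integrable b := integrable_of_bdd b c r A hr hb (Eventually.of_forall hbA) hb0
  rw [← lintegral_indicator (measurableSet_cube _ _),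
    lintegral_scale r hr c _ ((TS_meas j b hint).indicator (measurableSet_cube _ _))]
  calc ENNReal.ofReal (r ^ n) * ∫⁻ x, (Cube c (Λ * r)).indicator (TS j b) (c + r • x)
      ≤ ENNReal.ofReal (r ^ n) * ∫⁻ x, (Cube 0 Λ).indicator
          (fun x => ENNReal.ofReal A * TS j (fun z => A⁻¹ * b (c + r • z)) x) x := by
        gcongr with x
        by_cases h : x ∈ Cube 0 Λ
        · rw [Set.indicator_of_mem h, Set.indicator_of_mem ((mem_cube_scale c x r Λ hr).2 h)]
          exact TS_scale_le j r A hr hA c b x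
        · rw [Set.indicator_of_notMem h,
            Set.indicator_of_notMem (fun h' => h ((mem_cube_scale c x r Λ hr).1 h'))]
    _ = ENNReal.ofReal (r ^ n) * (ENNReal.ofReal A *
          ∫⁻ x in Cube 0 Λ, TS j (fun z => A⁻¹ * b (c + r • z)) x) := by
        rw [lintegral_indicator (measurableSet_cube _ _),
          lintegral_const_mul' _ _ ENNReal.ofReal_ne_top]
    _ ≤ ENNReal.ofReal (r ^ n) * (ENNReal.ofReal A * C) := by
        gcongr
        apply hC
        · fun_prop
        · intro z
          rw [abs_mul, abs_of_pos (by positivity), inv_mul_le_iff₀ hA, mul_one]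
          exact hbA _
        · intro z hz
          rw [hb0, mul_zero]
          intro h
          apply hz
          rw [← mem_cube_scale c z r 1 hr, one_mul]
          exact h
    _ = _ := by
        rw [ENNReal.ofReal_mul hA.le]; ring

theorem atom_far {n : ℕ} (j : Fin n) (c : Rn n) (r A : ℝ) (b : Rn n → ℝ) (hr : 0 < r) (hA : 0 < A)
    (hb : Measurable b) (hbA : ∀ᵐ z, |b z| ≤ A) (hb0 : ∀ z, z ∉ Cube c r → b z = 0)
    (hmean : ∫ z, b z = 0) (x : Rn n) (hx : x ∉ Cube c (2 * n * r)) :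
    TS j b x ≤ ENNReal.ofReal ((n + 2) * n * 4 ^ (n + 1) * (A * (2 * r) ^ n)) *
      ENNReal.ofReal (tk c r x) := by
  have hint : Integrable b := integrable_of_bdd b c r A hr hb hbA hb0
  have hn1 : (1 : ℝ) ≤ n := by exact_mod_cast Fin.pos j
  have hxc : 2 * n * r < ‖x - c‖ := by
    by_contra h
    push Not at h
    exact hx (ball_subset_cube _ _ (by rwa [Metric.mem_closedBall, dist_eq_norm]))
  apply TS_le
  intro ε hε
  have h1 : TT j ε b x = ∫ z, (Ker j ε (x - z) - Ker j ε (x - c)) * b z := by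
    simp only [sub_mul]
    rw [integral_sub (good_of_integrable j b hint ε hε x) (hint.const_mul _), integral_const_mul,
      hmean, mul_zero, sub_zero]
    rfl
  have htk := tk_nonneg c r hr x
  have h2 : ∀ z ∈ Cube c r, |Ker j ε (x - z) - Ker j ε (x - c)| ≤
      (n + 2) * n * 4 ^ (n + 1) * tk c r x := by
    intro z hz
    have h3 : ‖z - c‖ ≤ n * r := by
      have := cube_subset_ball c r hr.le hz
      rwa [Metric.mem_closedBall, dist_eq_norm] at this
    have h4 : ‖x - c‖ ≤ ‖x - z‖ + ‖z - c‖ := norm_sub_le_norm_sub_add_norm_sub _ _ _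
    have h6 : r ≤ n * r := le_mul_of_one_le_left hr.le hn1
    refine (ker_lip j ε (x - z) (x - c) ((r + ‖x - c‖) / 4) (by positivity)
      (le_max_of_le_left (by linarith)) (le_max_of_le_left (by linarith))).trans ?_
    have h5 : ‖x - z - (x - c)‖ ≤ n * r := by
      have h7 : x - z - (x - c) = -(z - c) := by abel
      rw [h7, norm_neg]; exact h3
    calc (n + 2) * ‖x - z - (x - c)‖ / ((r + ‖x - c‖) / 4) ^ (n + 1)
        ≤ (n + 2) * (n * r) / ((r + ‖x - c‖) / 4) ^ (n + 1) := by gcongr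
      _ = _ := by
        unfold tk
        rw [div_pow]
        field_simp
  rw [h1]
  refine (enorm_integral_le_lintegral_enorm _).trans ?_
  calc ∫⁻ z, ‖(Ker j ε (x - z) - Ker j ε (x - c)) * b z‖ₑ
      ≤ ∫⁻ z, (Cube c r).indicator (fun _ =>
          ENNReal.ofReal ((n + 2) * n * 4 ^ (n + 1) * tk c r x * A)) z := by
        apply lintegral_mono_ae
        filter_upwards [hbA] with z hz
        by_cases h : z ∈ Cube c r
        · rw [Set.indicator_of_mem h, Real.enorm_eq_ofReal_abs, abs_mul]
          apply ENNReal.ofReal_le_ofReal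
          gcongr
          exact h2 z h
        · simp [hb0 z h]
    _ = ENNReal.ofReal ((n + 2) * n * 4 ^ (n + 1) * tk c r x * A) *
          ENNReal.ofReal ((2 * r) ^ n) := by
        rw [lintegral_indicator (measurableSet_cube _ _), setLIntegral_const, volume_cube _ _ hr]
    _ = _ := by
        rw [← ENNReal.ofReal_mul (by positivity), ← ENNReal.ofReal_mul (by positivity)]
        congr 1
        ring

theorem atom_bound {n : ℕ} (j : Fin n) (C0 : ℝ≥0) (hC0 : LocalBd j (2 * n) C0) :
    ∃ C : ℝ≥0, ∀ (c : Rn n) (r A : ℝ) (b : Rn n → ℝ), 0 < r → 0 < A → Measurable b →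
      (∀ᵐ z, |b z| ≤ A) → (∀ z, z ∉ Cube c r → b z = 0) → ∫ z, b z = 0 →
      ∫⁻ z, TS j b z ≤ C * ENNReal.ofReal (A * r ^ n) := by
  obtain ⟨C1, hC1⟩ := tail_le (n := n)
  refine ⟨C0 + ((n + 2) * n * 4 ^ (n + 1) * 2 ^ n) * C1, ?_⟩
  intro c r A b hr hA hb hbA hb0 hmean
  rw [← lintegral_add_compl (TS j b) (measurableSet_cube c (2 * n * r))]
  have h1 := hC0 c r A b hr hA hb hbA hb0
  have h2 : ∫⁻ z in (Cube c (2 * n * r))ᶜ, TS j b z ≤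
      ENNReal.ofReal ((n + 2) * n * 4 ^ (n + 1) * (A * (2 * r) ^ n)) * C1 := by
    calc ∫⁻ z in (Cube c (2 * n * r))ᶜ, TS j b z ≤ ∫⁻ z in (Cube c (2 * n * r))ᶜ,
          ENNReal.ofReal ((n + 2) * n * 4 ^ (n + 1) * (A * (2 * r) ^ n)) *
            ENNReal.ofReal (tk c r z) := by
          apply setLIntegral_mono' (measurableSet_cube _ _).compl
          intro x hx
          exact atom_far j c r A b hr hA hb hbA hb0 hmean x hx
      _ ≤ ∫⁻ z, ENNReal.ofReal ((n + 2) * n * 4 ^ (n + 1) * (A * (2 * r) ^ n)) *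
            ENNReal.ofReal (tk c r z) := setLIntegral_le_lintegral _ _
      _ = ENNReal.ofReal ((n + 2) * n * 4 ^ (n + 1) * (A * (2 * r) ^ n)) *
            ∫⁻ z, ENNReal.ofReal (tk c r z) := lintegral_const_mul' _ _ ENNReal.ofReal_ne_top
      _ ≤ _ := by
          gcongr
          have h3 := hC1 (fun _ => 1) c c r measurable_const hr (by intro i; simp [hr.le])
          simp only [mul_one] at h3
          refine h3.trans ?_
          calc (C1 : ℝ≥0∞) * maximal (fun _ => 1) c ≤ C1 * 1 := by
                gcongr
                exact maximal_one_le c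
            _ = _ := mul_one _
  refine (add_le_add h1 h2).trans (le_of_eq ?_)
  have e : (n + 2) * n * 4 ^ (n + 1) * (A * (2 * r) ^ n) =
      ((n + 2) * n * 4 ^ (n + 1) * 2 ^ n) * (A * r ^ n) := by rw [mul_pow]; ring
  rw [e, ENNReal.ofReal_mul (p := (n + 2) * n * 4 ^ (n + 1) * 2 ^ n) (by positivity)]
  have e2 : ENNReal.ofReal ((n + 2) * n * 4 ^ (n + 1) * 2 ^ n) =
      (((n + 2) * n * 4 ^ (n + 1) * 2 ^ n : ℝ≥0) : ℝ≥0∞) := by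
    rw [ENNReal.ofReal_eq_coe_nnreal (by positivity)]
    rfl
  rw [e2]
  push_cast
  ring


/-- dyadic index -/
def kap {n : ℕ} (c : Rn n) (r : ℝ) (m : ℕ) (y : Rn n) : Fin n → ℤ :=
  fun i => ⌊2 ^ m * ((y i - c i + r) / (2 * r))⌋

/-- dyadic centre -/
def cen {n : ℕ} (c : Rn n) (r : ℝ) (m : ℕ) (k : Fin n → ℤ) : Rn n :=
  WithLp.toLp 2 fun i => c i - r + (2 * k i + 1) * (r / 2 ^ m)

theorem mem_cell {n : ℕ} (c : Rn n) (r : ℝ) (hr : 0 < r) (m : ℕ) (k : Fin n → ℤ) (y : Rn n) :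
    y ∈ HC (cen c r m k) (r / 2 ^ m) ↔ kap c r m y = k := by
  rw [funext_iff]
  simp only [HC, Set.mem_ofPred_eq, cen, kap, Int.floor_eq_iff]
  refine forall_congr' fun i => ?_
  have hp : (0 : ℝ) < 2 ^ m := by positivity
  have e : (2 : ℝ) ^ m * ((y i - c i + r) / (2 * r)) = (y i - c i + r) / (2 * (r / 2 ^ m)) := by
    field_simp
  rw [e, le_div_iff₀ (by positivity), div_lt_iff₀ (by positivity)]
  constructor
  · rintro ⟨h1, h2⟩; constructor <;> linarith
  · rintro ⟨h1, h2⟩; constructor <;> linarith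

theorem kap_succ {n : ℕ} (c : Rn n) (r : ℝ) (m : ℕ) (x y : Rn n)
    (h : kap c r (m + 1) x = kap c r (m + 1) y) : kap c r m x = kap c r m y := by
  have key : ∀ s t : ℝ, ⌊2 * s⌋ = ⌊2 * t⌋ → ⌊s⌋ ≤ ⌊t⌋ := by
    intro s t hst
    rw [Int.le_floor]
    have h1 : 2 * ⌊s⌋ ≤ ⌊2 * s⌋ := by
      rw [Int.le_floor]
      push_cast
      linarith [Int.floor_le s]
    rw [hst] at h1
    have h2 : ((2 * ⌊s⌋ : ℤ) : ℝ) ≤ (⌊2 * t⌋ : ℤ) := by exact_mod_cast h1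
    have h3 := Int.floor_le (2 * t)
    push_cast at h2
    linarith
  funext i
  have hi := congrFun h i
  simp only [kap, pow_succ', mul_assoc] at hi ⊢
  exact le_antisymm (key _ _ hi) (key _ _ hi.symm)

theorem kap_le {n : ℕ} (c : Rn n) (r : ℝ) (m m' : ℕ) (hm : m ≤ m') (x y : Rn n)
    (h : kap c r m' x = kap c r m' y) : kap c r m x = kap c r m y := by
  induction m', hm using Nat.le_induction with
  | base => exact h
  | succ k _ ih => exact ih (kap_succ c r k x y h)

theorem hc_eq_cell {n : ℕ} (c : Rn n) (r : ℝ) (hr : 0 < r) (y : Rn n) :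
    y ∈ HC c r ↔ kap c r 0 y = 0 := by
  rw [← mem_cell c r hr 0 0 y]
  have : cen c r 0 0 = c := by
    ext i
    simp [cen]
  rw [this]
  simp

theorem cen_mem {n : ℕ} (c : Rn n) (r : ℝ) (hr : 0 < r) : c ∈ HC c r := by
  intro i
  constructor <;> linarith

theorem leb {n : ℕ} (f : Rn n → ℝ) (hf : LocallyIntegrable f) (hfm : Measurable f)
    (r t : ℝ) (hr : 0 < r) (ht : 0 ≤ t) :
    ∀ᵐ x, (∀ m : ℕ, ∃ y, x ∈ HC y (r / 2 ^ m) ∧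
      ∫⁻ z in HC y (r / 2 ^ m), ‖f z‖ₑ ≤ ENNReal.ofReal (t * (2 * (r / 2 ^ m)) ^ n)) →
      |f x| ≤ t := by
  filter_upwards [IsUnifLocDoublingMeasure.ae_tendsto_average_norm_sub volume hf 1] with x hx H
  set δ : ℕ → ℝ := fun m => (n + 1) * (2 * (r / 2 ^ m)) with hδ
  have hδpos : ∀ m, 0 < δ m := fun m => by simp only [hδ]; positivity
  have hδ0 : Tendsto δ atTop (𝓝 0) := by
    have h1 : Tendsto (fun m : ℕ => ((n + 1) * (2 * r)) * ((1 / 2 : ℝ)) ^ m) atTop (𝓝 (((n + 1) * (2 * r)) * 0)) :=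
      (_root_.tendsto_pow_atTop_nhds_zero_of_lt_one (by norm_num) (by norm_num)).const_mul _
    rw [mul_zero] at h1
    refine h1.congr fun m => ?_
    simp only [hδ, one_div, inv_pow]
    ring
  have hδ1 : Tendsto δ atTop (𝓝[>] 0) := by
    rw [tendsto_nhdsWithin_iff]
    exact ⟨hδ0, Eventually.of_forall hδpos⟩
  have hlim := hx (fun _ => x) δ hδ1 (Eventually.of_forall fun m => by
    simp [(hδpos m).le])
  set B : ℝ := (n + 1) ^ n * (volume (Metric.ball (0 : Rn n) 1)).toReal with hB
  have hfin : volume (Metric.ball (0 : Rn n) 1) ≠ ⊤ := measure_ball_lt_top.ne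
  have hvb : ∀ m, volume (Metric.closedBall x (δ m)) =
      ENNReal.ofReal (B * (2 * (r / 2 ^ m)) ^ n) := by
    intro m
    rw [Measure.addHaar_closedBall _ _ (hδpos m).le, finrank_euclideanSpace, Fintype.card_fin]
    conv_lhs => rw [← ENNReal.ofReal_toReal hfin]
    rw [← ENNReal.ofReal_mul (by have := hδpos m; positivity)]
    congr 1
    simp only [hδ, hB, mul_pow]
    ring
  have key : ∀ m, |f x| ≤ B * (⨍ y in Metric.closedBall x (δ m), ‖f y - f x‖) + t := by
    intro m
    obtain ⟨y, hxy, hy⟩ := H m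
    set s := r / 2 ^ m with hs
    have hspos : 0 < s := by positivity
    have hv : (0 : ℝ) < (2 * s) ^ n := by positivity
    have hsub : HC y s ⊆ Metric.closedBall x (δ m) := by
      intro z hz
      rw [Metric.mem_closedBall, dist_eq_norm]
      refine (norm_le_of_coord (z - x) (2 * s) (by positivity) ?_).trans ?_
      · intro i
        have h1 := hz i
        have h2 := hxy i
        rw [PiLp.sub_apply, abs_le]
        constructor <;> linarith
      · simp only [hδ]
        gcongr
        linarith
    have hint : IntegrableOn (fun z => f z - f x) (Metric.closedBall x (δ m)) := by
      refine Integrable.sub (hf.integrableOn_isCompact (isCompact_closedBall _ _)) ?_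
      exact integrableOn_const measure_closedBall_lt_top.ne
    have e1 : ∫⁻ z in Metric.closedBall x (δ m), ‖f z - f x‖ₑ =
        ENNReal.ofReal (B * (2 * s) ^ n * ⨍ y in Metric.closedBall x (δ m), ‖f y - f x‖) := by
      rw [← ofReal_integral_norm_eq_lintegral_enorm hint]
      congr 1
      rw [← measure_smul_setAverage _ measure_closedBall_lt_top.ne, smul_eq_mul,
        measureReal_def, hvb, ENNReal.toReal_ofReal (by positivity)]
    have h3 : ENNReal.ofReal (|f x| * (2 * s) ^ n) ≤
        ENNReal.ofReal (B * (2 * s) ^ n * (⨍ y in Metric.closedBall x (δ m), ‖f y - f x‖) +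
          t * (2 * s) ^ n) := by
      calc ENNReal.ofReal (|f x| * (2 * s) ^ n) = ∫⁻ z in HC y s, ‖f x‖ₑ := by
            rw [setLIntegral_const, volume_hc _ _ hspos, Real.enorm_eq_ofReal_abs,
              ENNReal.ofReal_mul (abs_nonneg _)]
        _ ≤ ∫⁻ z in HC y s, (‖f z - f x‖ₑ + ‖f z‖ₑ) := by
            gcongr with z
            have : f x = -(f z - f x) + f z := by ring
            conv_lhs => rw [this]
            refine (enorm_add_le _ _).trans ?_
            rw [enorm_neg]
        _ = (∫⁻ z in HC y s, ‖f z - f x‖ₑ) + ∫⁻ z in HC y s, ‖f z‖ₑ :=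
            lintegral_add_left (by fun_prop) _
        _ ≤ (∫⁻ z in Metric.closedBall x (δ m), ‖f z - f x‖ₑ) + ∫⁻ z in HC y s, ‖f z‖ₑ := by
            gcongr
        _ ≤ _ := by
            rw [e1, ENNReal.ofReal_add _ (by positivity)]
            · gcongr
            · have : 0 ≤ ⨍ y in Metric.closedBall x (δ m), ‖f y - f x‖ := by
                rw [setAverage_eq]
                exact smul_nonneg (by positivity) (integral_nonneg fun _ => norm_nonneg _)
              positivity
    have h0 : 0 ≤ ⨍ y in Metric.closedBall x (δ m), ‖f y - f x‖ := by
      rw [setAverage_eq]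
      exact smul_nonneg (by positivity) (integral_nonneg fun _ => norm_nonneg _)
    rw [ENNReal.ofReal_le_ofReal_iff (by positivity)] at h3
    refine le_of_mul_le_mul_right (h3.trans (le_of_eq ?_)) hv
    ring
  have hl2 := (hlim.const_mul B).add_const t
  rw [mul_zero, zero_add] at hl2
  exact ge_of_tendsto' hl2 key

theorem cz {n : ℕ} (f : Rn n → ℝ) (hf : LocallyIntegrable f) (hfm : Measurable f) (c : Rn n)
    (r a : ℝ) (hr : 0 < r) (ha : 0 < a)
    (hav : ∫⁻ z in HC c r, ‖f z‖ₑ = ENNReal.ofReal (a * (2 * r) ^ n)) :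
    ∃ (ι : Type) (_ : Countable ι) (cc : ι → Rn n) (rr : ι → ℝ), (∀ i, 0 < rr i) ∧
      (∀ i, HC (cc i) (rr i) ⊆ HC c r) ∧
      Pairwise (Function.onFun Disjoint fun i => HC (cc i) (rr i)) ∧
      (∀ i, ENNReal.ofReal (2 * a * (2 * rr i) ^ n) < ∫⁻ z in HC (cc i) (rr i), ‖f z‖ₑ) ∧
      (∀ i, ∫⁻ z in HC (cc i) (rr i), ‖f z‖ₑ ≤ ENNReal.ofReal (2 ^ (n + 1) * a * (2 * rr i) ^ n)) ∧
      ∀ᵐ x, x ∈ HC c r → x ∉ ⋃ i, HC (cc i) (rr i) → |f x| ≤ 2 * a := by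
  classical
  let cell : ℕ → (Fin n → ℤ) → Set (Rn n) := fun m k => HC (cen c r m k) (r / 2 ^ m)
  let Bad : ℕ → (Fin n → ℤ) → Prop := fun m k =>
    ENNReal.ofReal (2 * a * (2 * (r / 2 ^ m)) ^ n) < ∫⁻ z in cell m k, ‖f z‖ₑ
  have hcell : ∀ m k y, y ∈ cell m k ↔ kap c r m y = k := fun m k y => mem_cell c r hr m k y
  have hcc : ∀ m k, kap c r m (cen c r m k) = k := fun m k =>
    (hcell m k _).1 (cen_mem _ _ (by positivity))
  have hcell0 : cell 0 0 = HC c r := by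
    ext y; rw [hcell, hc_eq_cell c r hr]
  have hbad0 : ¬ Bad 0 0 := by
    intro h
    have h' : ENNReal.ofReal (2 * a * (2 * (r / 2 ^ 0)) ^ n) < ∫⁻ z in cell 0 0, ‖f z‖ₑ := h
    rw [hcell0, hav, pow_zero, div_one] at h'
    have := (ENNReal.ofReal_lt_ofReal_iff (by positivity)).1 h'
    have hp : 0 < a * (2 * r) ^ n := by positivity
    linarith
  let P : ℕ × (Fin n → ℤ) → Prop := fun p => cell p.1 p.2 ⊆ HC c r ∧ Bad p.1 p.2 ∧
    ∀ m' < p.1, ∀ x ∈ cell p.1 p.2, ¬ Bad m' (kap c r m' x)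
  refine ⟨{p // P p}, inferInstance, fun p => cen c r p.1.1 p.1.2, fun p => r / 2 ^ p.1.1,
    fun p => by positivity, fun p => p.2.1, ?_, fun p => p.2.2.1, ?_, ?_⟩
  · have key : ∀ p q : {p // P p}, p ≠ q → p.1.1 ≤ q.1.1 → ∀ y, y ∈ cell p.1.1 p.1.2 →
        y ∈ cell q.1.1 q.1.2 → False := by
      intro p q hpq hle y hy1 hy2
      rcases hle.eq_or_lt with h | h
      · apply hpq
        apply Subtype.ext
        refine Prod.ext h ?_
        rw [hcell] at hy1 hy2
        rw [← hy1, ← hy2, h]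
      · have := q.2.2.2 _ h y hy2
        rw [(hcell _ _ _).1 hy1] at this
        exact this p.2.2.1
    intro p q hpq
    rw [Function.onFun, Set.disjoint_left]
    intro y hy1 hy2
    rcases le_total p.1.1 q.1.1 with h | h
    · exact key p q hpq h y hy1 hy2
    · exact key q p hpq.symm h y hy2 hy1
  · rintro ⟨⟨m, k⟩, hsub, hbad, hmin⟩
    simp only at hsub hbad hmin ⊢
    have hx : cen c r m k ∈ cell m k := cen_mem _ _ (by positivity)
    cases m with
    | zero =>
      exfalso
      have := (hc_eq_cell c r hr _).1 (hsub hx)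
      rw [hcc] at this
      rw [this] at hbad
      exact hbad0 hbad
    | succ m =>
      have h1 := hmin m (Nat.lt_succ_self m) _ hx
      have h2 : cell (m + 1) k ⊆ cell m (kap c r m (cen c r (m + 1) k)) := by
        intro y hy
        rw [hcell] at hy ⊢
        apply kap_succ
        rw [hy, hcc]
      have h3 : ∫⁻ z in cell m (kap c r m (cen c r (m + 1) k)), ‖f z‖ₑ ≤
        ENNReal.ofReal (2 * a * (2 * (r / 2 ^ m)) ^ n) := not_lt.1 h1
      refine (lintegral_mono_set h2).trans (h3.trans (le_of_eq ?_))
      congr 1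
      have : 2 * (r / 2 ^ m) = 2 * (2 * (r / 2 ^ (m + 1))) := by
        rw [pow_succ]; field_simp
      rw [this, mul_pow 2 (2 * (r / 2 ^ (m + 1)))]
      ring
  · filter_upwards [leb f hf hfm r (2 * a) hr (by positivity)] with x hx hxR hxU
    apply hx
    have hnb : ∀ m, ¬ Bad m (kap c r m x) := by
      by_contra hcon
      push Not at hcon
      have hmin := fun m' => Nat.find_min hcon (m := m')
      have hsp := Nat.find_spec hcon
      set m := Nat.find hcon
      apply hxU
      rw [Set.mem_iUnion]
      refine ⟨⟨(m, kap c r m x), ?_, hsp, ?_⟩, ?_⟩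
      · intro y hy
        have h1 := (hcell _ _ _).1 hy
        rw [hc_eq_cell c r hr] at hxR ⊢
        rw [← hxR]
        exact kap_le c r 0 m (Nat.zero_le _) _ _ h1
      · intro m' hm' y hy
        have h1 := (hcell _ _ _).1 hy
        rw [kap_le c r m' m (le_of_lt hm') _ _ h1]
        exact hmin m' hm'
      · exact (hcell _ _ _).2 rfl
    intro m
    exact ⟨cen c r m (kap c r m x), (hcell _ _ _).2 rfl, not_lt.1 (hnb m)⟩


theorem meas_tsum {α ι : Type*} [MeasurableSpace α] [Countable ι] (S : ι → Set α)
    (hd : Pairwise (Function.onFun Disjoint S)) (g : ι → α → ℝ) (hg : ∀ i, Measurable (g i))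
    (h0 : ∀ i z, z ∉ S i → g i z = 0) : Measurable fun z => ∑' i, g i z := by
  have e : (fun z => ∑' i, g i z) = fun z => (((∑' i, (g i z).toNNReal : ℝ≥0)) : ℝ) -
      ((∑' i, (-g i z).toNNReal : ℝ≥0) : ℝ) := by
    funext z
    by_cases h : ∃ i, z ∈ S i
    · obtain ⟨i, hi⟩ := h
      have hk : ∀ k, k ≠ i → g k z = 0 := by
        intro k hki
        apply h0
        intro hz
        exact Set.disjoint_left.1 (hd hki) hz hi
      rw [tsum_eq_single i hk, tsum_eq_single i (fun k hki => by simp [hk k hki]),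
        tsum_eq_single i (fun k hki => by simp [hk k hki])]
      simp only [Real.coe_toNNReal']
      rcases le_total 0 (g i z) with h | h
      · rw [max_eq_left h, max_eq_right (by linarith)]; ring
      · rw [max_eq_right h, max_eq_left (by linarith)]; ring
    · push Not at h
      have hk : ∀ k, g k z = 0 := fun k => h0 k z (h k)
      simp [hk]
  rw [e]
  refine Measurable.sub ?_ ?_
  · exact (Measurable.tsum fun i => (hg i).real_toNNReal).coe_nnreal_real
  · exact (Measurable.tsum fun i => (hg i).neg.real_toNNReal).coe_nnreal_real

theorem TS_tsum {n : ℕ} {ι : Type} [Countable ι] (j : Fin n) (g : ι → Rn n → ℝ)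
    (hg : ∀ i, Measurable (g i)) (hs : ∑' i, ∫⁻ z, ‖g i z‖ₑ ≠ ⊤) (x : Rn n) :
    TS j (fun z => ∑' i, g i z) x ≤ ∑' i, TS j (g i) x := by
  apply TS_le
  intro ε hε
  have hm : ∀ i, Measurable fun z => Ker j ε (x - z) * g i z := fun i =>
    (((ker_cont j ε hε).measurable).comp (by fun_prop)).mul (hg i)
  have h1 : TT j ε (fun z => ∑' i, g i z) x = ∑' i, TT j ε (g i) x := by
    unfold TT
    rw [← integral_tsum]
    · congr 1
      ext z
      exact tsum_mul_left.symm
    · exact fun i => (hm i).aestronglyMeasurable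
    · have : ∑' i, ∫⁻ z, ‖Ker j ε (x - z) * g i z‖ₑ ≤
          ENNReal.ofReal (ε ^ n)⁻¹ * ∑' i, ∫⁻ z, ‖g i z‖ₑ := by
        rw [← ENNReal.tsum_mul_left]
        refine ENNReal.tsum_le_tsum fun i => ?_
        rw [← lintegral_const_mul' _ _ ENNReal.ofReal_ne_top]
        refine lintegral_mono fun z => ?_
        rw [enorm_mul, Real.enorm_eq_ofReal_abs]
        gcongr
        exact ker_abs_le j ε hε _
      exact ne_top_of_le_ne_top (ENNReal.mul_ne_top ENNReal.ofReal_ne_top hs) this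
  rw [h1]
  refine enorm_tsum_le_tsum_enorm.trans ?_
  exact ENNReal.tsum_le_tsum fun i => le_TS j ε hε _ _

/-- mean over half-open cube -/
def mn {n : ℕ} (f : Rn n → ℝ) (c : Rn n) (r : ℝ) : ℝ := ((2 * r) ^ n)⁻¹ * ∫ z in HC c r, f z

/-- localized oscillation -/
def osc {n : ℕ} (f : Rn n → ℝ) (c : Rn n) (r : ℝ) : Rn n → ℝ :=
  (HC c r).indicator fun z => f z - mn f c r

theorem mn_abs_le {n : ℕ} (f : Rn n → ℝ) (c : Rn n) (r t : ℝ) (hr : 0 < r) (ht : 0 ≤ t)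
    (h : ∫⁻ z in HC c r, ‖f z‖ₑ ≤ ENNReal.ofReal (t * (2 * r) ^ n)) : |mn f c r| ≤ t := by
  have h1 : |∫ z in HC c r, f z| ≤ t * (2 * r) ^ n := by
    have := (enorm_integral_le_lintegral_enorm (μ := volume.restrict (HC c r)) f).trans h
    rw [Real.enorm_eq_ofReal_abs] at this
    exact (ENNReal.ofReal_le_ofReal_iff (by positivity)).1 this
  unfold mn
  have hp : (0 : ℝ) < (2 * r) ^ n := by positivity
  rw [abs_mul, abs_of_pos (inv_pos.2 hp), inv_mul_le_iff₀ hp, mul_comm]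
  exact h1

theorem osc_meas {n : ℕ} (f : Rn n → ℝ) (hf : Measurable f) (c : Rn n) (r : ℝ) :
    Measurable (osc f c r) := (hf.sub_const _).indicator (measurableSet_hc _ _)

theorem osc_out {n : ℕ} (f : Rn n → ℝ) (c : Rn n) (r : ℝ) (z : Rn n) (hz : z ∉ HC c r) :
    osc f c r z = 0 := Set.indicator_of_notMem hz _

theorem osc_in {n : ℕ} (f : Rn n → ℝ) (c : Rn n) (r : ℝ) (z : Rn n) (hz : z ∈ HC c r) :
    osc f c r z = f z - mn f c r := Set.indicator_of_mem hz _

theorem osc_integral {n : ℕ} (f : Rn n → ℝ) (c : Rn n) (r : ℝ) (hr : 0 < r)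
    (hf : IntegrableOn f (HC c r)) : ∫ z, osc f c r z = 0 := by
  unfold osc
  have hp : (0 : ℝ) < (2 * r) ^ n := by positivity
  rw [integral_indicator (measurableSet_hc _ _), integral_sub hf, setIntegral_const,
    measureReal_def, volume_hc _ _ hr, ENNReal.toReal_ofReal hp.le, mn, smul_eq_mul]
  · field_simp
    ring
  · exact integrableOn_const (by rw [volume_hc _ _ hr]; exact ENNReal.ofReal_ne_top)

theorem lint_le {n : ℕ} (f : Rn n → ℝ) (N : ℝ) (hN : 0 ≤ N) (hfN : ∀ z, |f z| ≤ N) (c : Rn n)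
    (r : ℝ) (hr : 0 < r) : ∫⁻ z in HC c r, ‖f z‖ₑ ≤ ENNReal.ofReal (N * (2 * r) ^ n) := by
  calc ∫⁻ z in HC c r, ‖f z‖ₑ ≤ ∫⁻ z in HC c r, ENNReal.ofReal N := by
        gcongr with z
        rw [Real.enorm_eq_ofReal_abs]
        exact ENNReal.ofReal_le_ofReal (hfN z)
    _ = _ := by rw [setLIntegral_const, volume_hc _ _ hr, ENNReal.ofReal_mul hN]

theorem osc_bound {n : ℕ} (f : Rn n → ℝ) (N : ℝ) (hN : 0 ≤ N) (hfN : ∀ z, |f z| ≤ N) (c : Rn n)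
    (r : ℝ) (hr : 0 < r) (z : Rn n) : |osc f c r z| ≤ 2 * N := by
  by_cases h : z ∈ HC c r
  · rw [osc_in f c r z h]
    have h1 := mn_abs_le f c r N hr hN (lint_le f N hN hfN c r hr)
    have h2 := abs_sub (f z) (mn f c r)
    linarith [hfN z]
  · rw [osc_out f c r z h]; simp; exact hN

theorem osc_integrable {n : ℕ} (f : Rn n → ℝ) (hf : Measurable f) (N : ℝ) (hN : 0 ≤ N)
    (hfN : ∀ z, |f z| ≤ N) (c : Rn n) (r : ℝ) (hr : 0 < r) : Integrable (osc f c r) :=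
  integrable_of_bdd _ c r (2 * N) hr (osc_meas f hf c r)
    (Eventually.of_forall (osc_bound f N hN hfN c r hr))
    (fun z hz => osc_out f c r z fun h => hz (hc_subset_cube _ _ h))

theorem avg_le_max {n : ℕ} (f : Rn n → ℝ) (c : Rn n) (r a : ℝ) (hr : 0 < r) (ha : 0 ≤ a)
    (h : ENNReal.ofReal (a * (2 * r) ^ n) ≤ ∫⁻ z in HC c r, ‖f z‖ₑ) (x : Rn n)
    (hx : x ∈ Cube c r) : ENNReal.ofReal a ≤ maximalR f x := by
  have h1 : ENNReal.ofReal (a * (2 * r) ^ n) ≤ ENNReal.ofReal ((2 * r) ^ n) * maximalR f x :=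
    h.trans ((lintegral_mono_set (hc_subset_cube _ _)).trans (int_cube_le _ x c r hr hx))
  rw [ENNReal.ofReal_mul ha, mul_comm] at h1
  rwa [ENNReal.mul_le_mul_iff_right _ ENNReal.ofReal_ne_top] at h1
  simp only [ne_eq, ENNReal.ofReal_eq_zero, not_le]
  positivity

theorem cz_step {n : ℕ} (j : Fin n) (C1 : ℝ≥0)
    (hC1 : ∀ (c : Rn n) (r A : ℝ) (b : Rn n → ℝ), 0 < r → 0 < A → Measurable b →
      (∀ᵐ z, |b z| ≤ A) → (∀ z, z ∉ Cube c r → b z = 0) → ∫ z, b z = 0 →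
      ∫⁻ z, TS j b z ≤ C1 * ENNReal.ofReal (A * r ^ n))
    (f : Rn n → ℝ) (hf : Measurable f) (N : ℝ) (hN : 0 ≤ N) (hfN : ∀ z, |f z| ≤ N) (K : ℕ) :
    ∀ (c : Rn n) (r a : ℝ), 0 < r → 0 < a →
      ∫⁻ z in HC c r, ‖f z‖ₑ = ENNReal.ofReal (a * (2 * r) ^ n) → N < 2 ^ K * a →
      ∫⁻ z, TS j (osc f c r) z ≤ (C1 * (2 ^ (n + 1) + 1) * 2 : ℝ≥0) *
        ∫⁻ z in HC c r, maximalR f z := by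
  induction K with
  | zero =>
    intro c r a hr ha hav hNa
    exfalso
    have h1 := lint_le f N hN hfN c r hr
    have hp : (0 : ℝ) < (2 * r) ^ n := by positivity
    rw [hav, ENNReal.ofReal_le_ofReal_iff (by positivity)] at h1
    have := le_of_mul_le_mul_right h1 hp
    rw [pow_zero, one_mul] at hNa
    linarith
  | succ K IH =>
    intro c r a hr ha hav hNa
    have hloc : LocallyIntegrable f := by
      refine (locallyIntegrable_const N).mono hf.aestronglyMeasurable (Eventually.of_forall ?_)
      intro z
      rw [Real.norm_of_nonneg hN]
      exact hfN z
    have hIon : ∀ c r, 0 < r → IntegrableOn f (HC c r) := by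
      intro c r hr
      refine Measure.integrableOn_of_bounded (M := N) ?_ hf.aestronglyMeasurable
        (Eventually.of_forall hfN)
      rw [volume_hc _ _ hr]; exact ENNReal.ofReal_ne_top
    obtain ⟨ι, hι, cc, rr, hrr, hsub, hdisj, hlow, hup, hae⟩ := cz f hloc hf c r a hr ha hav
    set S : ι → Set (Rn n) := fun i => HC (cc i) (rr i) with hS
    have hSm : ∀ i, MeasurableSet (S i) := fun i => measurableSet_hc _ _
    have hUm : MeasurableSet (⋃ i, S i) := MeasurableSet.iUnion hSm
    have hUR : (⋃ i, S i) ⊆ HC c r := Set.iUnion_subset hsub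
    set g : ι → Rn n → ℝ := fun i => osc f (cc i) (rr i) with hg
    have hgm : ∀ i, Measurable (g i) := fun i => osc_meas f hf _ _
    have hg0 : ∀ i z, z ∉ S i → g i z = 0 := fun i z hz => osc_out f _ _ z hz
    have hgI : ∀ i, Integrable (g i) := fun i => osc_integrable f hf N hN hfN _ _ (hrr i)
    have hvR : volume (HC c r) ≠ ⊤ := by rw [volume_hc _ _ hr]; exact ENNReal.ofReal_ne_top
    have hsum : ∑' i, ∫⁻ z, ‖g i z‖ₑ ≠ ⊤ := by
      have : ∑' i, ∫⁻ z, ‖g i z‖ₑ ≤ ENNReal.ofReal (2 * N) * volume (HC c r) := by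
        calc ∑' i, ∫⁻ z, ‖g i z‖ₑ ≤ ∑' i, ENNReal.ofReal (2 * N) * volume (S i) := by
              refine ENNReal.tsum_le_tsum fun i => ?_
              rw [← setLIntegral_const, ← lintegral_indicator (hSm i)]
              refine lintegral_mono fun z => ?_
              by_cases h : z ∈ S i
              · rw [Set.indicator_of_mem h, Real.enorm_eq_ofReal_abs]
                exact ENNReal.ofReal_le_ofReal (osc_bound f N hN hfN _ _ (hrr i) z)
              · simp [hg0 i z h]
          _ = ENNReal.ofReal (2 * N) * volume (⋃ i, S i) := by
              rw [ENNReal.tsum_mul_left, measure_iUnion hdisj hSm]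
          _ ≤ _ := by gcongr
      exact ne_top_of_le_ne_top (ENNReal.mul_ne_top ENNReal.ofReal_ne_top hvR) this
    set h : Rn n → ℝ := fun z => ∑' i, g i z with hh
    have hhm : Measurable h := meas_tsum S hdisj g hgm hg0
    have hhI : Integrable h := by
      refine ⟨hhm.aestronglyMeasurable, ?_⟩
      rw [hasFiniteIntegral_iff_enorm]
      calc ∫⁻ z, ‖h z‖ₑ ≤ ∫⁻ z, ∑' i, ‖g i z‖ₑ := lintegral_mono fun z => enorm_tsum_le_tsum_enorm
        _ = ∑' i, ∫⁻ z, ‖g i z‖ₑ := lintegral_tsum fun i => (hgm i).enorm.aemeasurable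
        _ < ⊤ := hsum.lt_top
    have hhz : ∫ z, h z = 0 := by
      rw [hh, integral_tsum (fun i => (hgm i).aestronglyMeasurable) hsum]
      have : ∀ i, ∫ z, g i z = 0 := fun i => osc_integral f _ _ (hrr i) (hIon _ _ (hrr i))
      simp [this]
    have hhin : ∀ i z, z ∈ S i → h z = f z - mn f (cc i) (rr i) := by
      intro i z hz
      rw [← osc_in f _ _ z hz]
      refine tsum_eq_single i fun k hk => hg0 k z fun hzk => ?_
      exact Set.disjoint_left.1 (hdisj hk) hzk hz
    have hhout : ∀ z, z ∉ (⋃ i, S i) → h z = 0 := by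
      intro z hz
      have : ∀ i, g i z = 0 := fun i => hg0 i z fun hi => hz (Set.mem_iUnion.2 ⟨i, hi⟩)
      simp [hh, this]
    set o := osc f c r with ho
    have hoI : Integrable o := osc_integrable f hf N hN hfN c r hr
    have hom : Measurable o := osc_meas f hf c r
    set b : Rn n → ℝ := fun z => o z - h z with hb
    have hbI : Integrable b := hoI.sub hhI
    have hbm : Measurable b := hom.sub hhm
    have hmnR : |mn f c r| ≤ a := mn_abs_le f c r a hr ha.le hav.le
    have h2n : (2 : ℝ) ≤ 2 ^ (n + 1) := by
      rw [pow_succ]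
      have : (1 : ℝ) ≤ 2 ^ n := one_le_pow₀ one_le_two
      linarith
    have hbA : ∀ᵐ z, |b z| ≤ (2 ^ (n + 1) + 1) * a := by
      filter_upwards [hae] with z hz
      by_cases hzR : z ∈ HC c r
      · by_cases hzU : z ∈ ⋃ i, S i
        · obtain ⟨i, hi⟩ := Set.mem_iUnion.1 hzU
          have e : b z = mn f (cc i) (rr i) - mn f c r := by
            simp only [hb]
            rw [hhin i z hi, ho, osc_in f c r z hzR]; ring
          have h1 := mn_abs_le f (cc i) (rr i) (2 ^ (n + 1) * a) (hrr i) (by positivity) (hup i)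
          have h2 := abs_sub (mn f (cc i) (rr i)) (mn f c r)
          rw [e]
          linarith
        · have h1 := hz hzR hzU
          have e : b z = f z - mn f c r := by
            simp only [hb]
            rw [hhout z hzU, ho, osc_in f c r z hzR]; ring
          have h2 := abs_sub (f z) (mn f c r)
          rw [e]
          nlinarith
      · have e : b z = 0 := by
          simp only [hb]
          rw [hhout z (fun hh => hzR (hUR hh)), ho, osc_out f c r z hzR]; ring
        rw [e, abs_zero]; positivity
    have hb0 : ∀ z, z ∉ Cube c r → b z = 0 := by
      intro z hz
      have hzR : z ∉ HC c r := fun hh => hz (hc_subset_cube _ _ hh)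
      simp only [hb]
      rw [hhout z (fun hh => hzR (hUR hh)), ho, osc_out f c r z hzR]; ring
    have hbz : ∫ z, b z = 0 := by
      simp only [hb]
      rw [integral_sub hoI hhI, hhz, ho, osc_integral f c r hr (hIon c r hr), sub_zero]
    have hTSb := hC1 c r ((2 ^ (n + 1) + 1) * a) b hr (by positivity) hbm hbA hb0 hbz
    -- the small cubes
    have hIH : ∀ i, ∫⁻ z, TS j (g i) z ≤ (C1 * (2 ^ (n + 1) + 1) * 2 : ℝ≥0) *
        ∫⁻ z in S i, maximalR f z := by
      intro i
      have hp : (0 : ℝ) < (2 * rr i) ^ n := by have := hrr i; positivity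
      have hfin : ∫⁻ z in S i, ‖f z‖ₑ ≠ ⊤ := ne_top_of_le_ne_top ENNReal.ofReal_ne_top (hup i)
      set a' := (∫⁻ z in S i, ‖f z‖ₑ).toReal / (2 * rr i) ^ n with ha'
      have e : ∫⁻ z in S i, ‖f z‖ₑ = ENNReal.ofReal (a' * (2 * rr i) ^ n) := by
        rw [ha', div_mul_cancel₀ _ hp.ne', ENNReal.ofReal_toReal hfin]
      have hlow' : 2 * a < a' := by
        have h1 := hlow i
        change _ < ∫⁻ z in S i, ‖f z‖ₑ at h1
        rw [e] at h1
        have h2 := lt_of_mul_lt_mul_right (ENNReal.ofReal_lt_ofReal_iff_of_nonneg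
          (by positivity) |>.1 h1) hp.le
        exact h2
      refine IH (cc i) (rr i) a' (hrr i) (by linarith) e ?_
      rw [pow_succ] at hNa
      have : (0 : ℝ) < 2 ^ K := by positivity
      nlinarith
    have hbig : ENNReal.ofReal (a * (2 * r) ^ n) ≤ 2 * ∫⁻ z in HC c r \ ⋃ i, S i, maximalR f z := by
      set p := ENNReal.ofReal a * volume (⋃ i, S i) with hp
      set q := ENNReal.ofReal a * volume (HC c r \ ⋃ i, S i) with hq
      have hpq : p + q = ENNReal.ofReal (a * (2 * r) ^ n) := by
        rw [hp, hq, ← mul_add, ENNReal.ofReal_mul ha.le, ← volume_hc c r hr]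
        congr 1
        rw [← measure_union Set.disjoint_sdiff_right ((measurableSet_hc _ _).diff hUm),
          Set.union_sdiff_cancel hUR]
      have hpfin : p ≠ ⊤ := by
        intro h
        rw [h, top_add] at hpq
        exact ENNReal.ofReal_ne_top hpq.symm
      have h2p : p + p ≤ p + q := by
        rw [hpq, ← hav]
        calc p + p = ∑' i, ENNReal.ofReal (2 * a) * volume (S i) := by
              rw [ENNReal.tsum_mul_left, ← measure_iUnion hdisj hSm, hp,
                ENNReal.ofReal_mul (by norm_num)]
              simp
              ring
          _ ≤ ∑' i, ∫⁻ z in S i, ‖f z‖ₑ := by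
              refine ENNReal.tsum_le_tsum fun i => ?_
              rw [volume_hc _ _ (hrr i), ← ENNReal.ofReal_mul (by positivity)]
              exact (hlow i).le
          _ = ∫⁻ z in ⋃ i, S i, ‖f z‖ₑ := (lintegral_iUnion hSm hdisj _).symm
          _ ≤ _ := lintegral_mono_set hUR
      have hpq' : p ≤ q := (ENNReal.add_le_add_iff_left hpfin).1 h2p
      have hqM : q ≤ ∫⁻ z in HC c r \ ⋃ i, S i, maximalR f z := by
        rw [hq, ← setLIntegral_const]
        apply setLIntegral_mono' ((measurableSet_hc _ _).diff hUm)
        intro x hx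
        exact avg_le_max f c r a hr ha.le hav.ge x (hc_subset_cube _ _ hx.1)
      rw [← hpq, two_mul]
      exact add_le_add (hpq'.trans hqM) hqM
    have hob : ∀ x, TS j o x ≤ TS j b x + ∑' i, TS j (g i) x := by
      intro x
      have e : o = fun z => b z + h z := by
        funext z; simp [hb]
      rw [e]
      refine (TS_add_le j b h (good_of_integrable j b hbI) (good_of_integrable j h hhI) x).trans ?_
      gcongr
      exact TS_tsum j g hgm hsum x
    calc ∫⁻ z, TS j o z ≤ ∫⁻ z, (TS j b z + ∑' i, TS j (g i) z) := lintegral_mono hob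
      _ = (∫⁻ z, TS j b z) + ∑' i, ∫⁻ z, TS j (g i) z := by
          rw [lintegral_add_left (TS_meas j b hbI),
            lintegral_tsum fun i => (TS_meas j (g i) (hgI i)).aemeasurable]
      _ ≤ C1 * (ENNReal.ofReal (2 ^ (n + 1) + 1) * ENNReal.ofReal (a * (2 * r) ^ n)) +
          ∑' i, (C1 * (2 ^ (n + 1) + 1) * 2 : ℝ≥0) * ∫⁻ z in S i, maximalR f z := by
          refine add_le_add (hTSb.trans ?_) (ENNReal.tsum_le_tsum hIH)
          rw [← ENNReal.ofReal_mul (by positivity), ← mul_assoc]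
          gcongr
          linarith
      _ ≤ C1 * (ENNReal.ofReal (2 ^ (n + 1) + 1) * (2 * ∫⁻ z in HC c r \ ⋃ i, S i, maximalR f z)) +
          (C1 * (2 ^ (n + 1) + 1) * 2 : ℝ≥0) * ∫⁻ z in ⋃ i, S i, maximalR f z := by
          rw [ENNReal.tsum_mul_left, ← lintegral_iUnion hSm hdisj]
          gcongr
      _ = (C1 * (2 ^ (n + 1) + 1) * 2 : ℝ≥0) * ((∫⁻ z in HC c r \ ⋃ i, S i, maximalR f z) +
            ∫⁻ z in ⋃ i, S i, maximalR f z) := by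
          have e2 : ENNReal.ofReal (2 ^ (n + 1) + 1) = ((2 ^ (n + 1) + 1 : ℝ≥0) : ℝ≥0∞) := by
            rw [ENNReal.ofReal_eq_coe_nnreal (by positivity)]
            rfl
          rw [e2]
          push_cast
          ring
      _ = _ := by
          congr 1
          rw [← lintegral_union hUm Set.disjoint_sdiff_left, Set.sdiff_union_of_subset hUR]


theorem TS_zero {n : ℕ} (j : Fin n) (f : Rn n → ℝ) (h : f =ᵐ[volume] 0) (x : Rn n) :
    TS j f x = 0 := by
  rw [TS_congr j f 0 h]
  apply le_antisymm _ (zero_le)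
  apply TS_le
  intro ε hε
  simp [TT]

theorem local_bdd {n : ℕ} (j : Fin n) (C0 : ℝ≥0) (hC0 : LocalBd j (2 * n) C0) :
    ∃ C : ℝ≥0, ∀ (f : Rn n → ℝ) (N : ℝ), Measurable f → 0 ≤ N → (∀ z, |f z| ≤ N) →
      ∀ (c : Rn n) (r : ℝ), 0 < r →
      ∫⁻ z in Cube c r, TS j ((HC c r).indicator f) z ≤ C * ∫⁻ z in HC c r, maximalR f z := by
  obtain ⟨C1, hC1⟩ := atom_bound j C0 hC0
  refine ⟨C0 + (C1 * (2 ^ (n + 1) + 1) * 2), ?_⟩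
  intro f N hf hN hfN c r hr
  have hn1 : (1 : ℝ) ≤ n := by exact_mod_cast Fin.pos j
  have hp : (0 : ℝ) < (2 * r) ^ n := by positivity
  have hIle := lint_le f N hN hfN c r hr
  have hfin : ∫⁻ z in HC c r, ‖f z‖ₑ ≠ ⊤ := ne_top_of_le_ne_top ENNReal.ofReal_ne_top hIle
  set a := (∫⁻ z in HC c r, ‖f z‖ₑ).toReal / (2 * r) ^ n with ha
  have e : ∫⁻ z in HC c r, ‖f z‖ₑ = ENNReal.ofReal (a * (2 * r) ^ n) := by
    rw [ha, div_mul_cancel₀ _ hp.ne', ENNReal.ofReal_toReal hfin]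
  have ha0 : 0 ≤ a := by positivity
  rcases ha0.eq_or_lt with h0 | hapos
  · rw [← h0, zero_mul, ENNReal.ofReal_zero, ← lintegral_indicator (measurableSet_hc _ _),
      lintegral_eq_zero_iff (by exact (hf.enorm).indicator (measurableSet_hc _ _))] at e
    have hz : (HC c r).indicator f =ᵐ[volume] 0 := by
      filter_upwards [e] with z hz
      by_cases h : z ∈ HC c r
      · rw [Set.indicator_of_mem h] at hz ⊢
        simpa using hz
      · rw [Set.indicator_of_notMem h]; rfl
    simp [TS_zero j _ hz]
  obtain ⟨K, hK⟩ := pow_unbounded_of_one_lt (N / a) one_lt_two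
  rw [div_lt_iff₀ hapos] at hK
  have hosc := cz_step j C1 hC1 f hf N hN hfN K c r a hr hapos e hK
  set k : Rn n → ℝ := (HC c r).indicator fun _ => mn f c r with hk
  have hkm : Measurable k := measurable_const.indicator (measurableSet_hc _ _)
  have hka : ∀ z, |k z| ≤ a := by
    intro z
    by_cases h : z ∈ HC c r
    · simp only [hk, Set.indicator_of_mem h]
      exact mn_abs_le f c r a hr ha0 e.le
    · simp only [hk, Set.indicator_of_notMem h, abs_zero]
      exact ha0
  have hk0 : ∀ z, z ∉ Cube c r → k z = 0 := fun z hz =>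
    Set.indicator_of_notMem (fun h => hz (hc_subset_cube _ _ h)) _
  have hkI : Integrable k := integrable_of_bdd k c r a hr hkm (Eventually.of_forall hka) hk0
  have hoI := osc_integrable f hf N hN hfN c r hr
  have hsplit : (HC c r).indicator f = fun z => k z + osc f c r z := by
    funext z
    by_cases h : z ∈ HC c r
    · simp only [hk, Set.indicator_of_mem h, osc_in f c r z h]; ring
    · simp only [hk, Set.indicator_of_notMem h, osc_out f c r z h]; ring
  have hloc := hC0 c r a k hr hapos hkm (Eventually.of_forall hka) hk0
  have hM : ENNReal.ofReal (a * r ^ n) ≤ ∫⁻ z in HC c r, maximalR f z := by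
    calc ENNReal.ofReal (a * r ^ n) ≤ ENNReal.ofReal (a * (2 * r) ^ n) := by
          gcongr; linarith
      _ = ∫⁻ z in HC c r, ENNReal.ofReal a := by
          rw [setLIntegral_const, volume_hc _ _ hr, ENNReal.ofReal_mul ha0]
      _ ≤ _ := by
          apply setLIntegral_mono' (measurableSet_hc _ _)
          intro x hx
          exact avg_le_max f c r a hr ha0 e.ge x (hc_subset_cube _ _ hx)
  calc ∫⁻ z in Cube c r, TS j ((HC c r).indicator f) z
      ≤ ∫⁻ z in Cube c r, (TS j k z + TS j (osc f c r) z) := by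
        rw [hsplit]
        refine lintegral_mono fun z => ?_
        exact TS_add_le j k _ (good_of_integrable j k hkI) (good_of_integrable j _ hoI) z
    _ = (∫⁻ z in Cube c r, TS j k z) + ∫⁻ z in Cube c r, TS j (osc f c r) z :=
        lintegral_add_left (TS_meas j k hkI) _
    _ ≤ (∫⁻ z in Cube c (2 * n * r), TS j k z) + ∫⁻ z, TS j (osc f c r) z := by
        refine add_le_add (lintegral_mono_set (cube_mono c ?_)) (setLIntegral_le_lintegral _ _)
        nlinarith
    _ ≤ C0 * (∫⁻ z in HC c r, maximalR f z) + (C1 * (2 ^ (n + 1) + 1) * 2 : ℝ≥0) *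
          ∫⁻ z in HC c r, maximalR f z := by
        refine add_le_add (hloc.trans ?_) hosc
        gcongr
    _ = _ := by push_cast; ring

theorem local_full {n : ℕ} (j : Fin n) (C0 : ℝ≥0) (hC0 : LocalBd j (2 * n) C0) :
    ∃ C : ℝ≥0, ∀ (f : Rn n → ℝ), Measurable f → 
      ∀ (c : Rn n) (r : ℝ), 0 < r → IntegrableOn f (HC c r) →
      ∫⁻ z in Cube c r, TS j ((HC c r).indicator f) z ≤ C * ∫⁻ z in HC c r, maximalR f z := by
  obtain ⟨C, hC⟩ := local_bdd j C0 hC0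
  refine ⟨C, ?_⟩
  intro f hf c r hr hI
  set F : ℕ → Rn n → ℝ := fun N => {z | |f z| ≤ N}.indicator f with hF
  have hSm : ∀ N : ℕ, MeasurableSet {z | |f z| ≤ N} := fun N =>
    measurableSet_le (by fun_prop) measurable_const
  have hFm : ∀ N, Measurable (F N) := fun N => hf.indicator (hSm N)
  have hFN : ∀ N z, |F N z| ≤ N := by
    intro N z
    by_cases h : z ∈ {z | |f z| ≤ N}
    · simp only [hF, Set.indicator_of_mem h]; exact h
    · simp only [hF, Set.indicator_of_notMem h, abs_zero]; positivity
  have hFf : ∀ N z, |F N z| ≤ |f z| := by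
    intro N z
    by_cases h : z ∈ {z | |f z| ≤ N}
    · simp only [hF, Set.indicator_of_mem h]; exact le_rfl
    · simp only [hF, Set.indicator_of_notMem h, abs_zero]; positivity
  have hFlim : ∀ z, ∀ᶠ N in atTop, F N z = f z := by
    intro z
    obtain ⟨N0, hN0⟩ := exists_nat_ge |f z|
    filter_upwards [eventually_ge_atTop N0] with N hN
    have : z ∈ {z | |f z| ≤ N} := hN0.trans (by exact_mod_cast hN)
    simp only [hF, Set.indicator_of_mem this]
  have hfI : Integrable ((HC c r).indicator f) :=
    (integrable_indicator_iff (measurableSet_hc _ _)).2 hI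
  have hdom : ∀ N z, ‖(HC c r).indicator (F N) z‖ ≤ ‖(HC c r).indicator f z‖ := by
    intro N z
    by_cases h : z ∈ HC c r
    · simp only [Set.indicator_of_mem h]; exact hFf N z
    · simp only [Set.indicator_of_notMem h]; exact le_rfl
  have hFI : ∀ N, Integrable ((HC c r).indicator (F N)) := fun N =>
    hfI.mono ((hFm N).indicator (measurableSet_hc _ _)).aestronglyMeasurable
      (Eventually.of_forall (hdom N))
  have hpt : ∀ x, TS j ((HC c r).indicator f) x ≤
      liminf (fun N => TS j ((HC c r).indicator (F N)) x) atTop := by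
    intro x
    apply TS_le
    intro ε hε
    have ht : Tendsto (fun N => TT j ε ((HC c r).indicator (F N)) x) atTop
        (𝓝 (TT j ε ((HC c r).indicator f) x)) := by
      unfold TT
      refine tendsto_integral_of_dominated_convergence
        (fun z => (ε ^ n)⁻¹ * ‖(HC c r).indicator f z‖) ?_ (hfI.norm.const_mul _) ?_ ?_
      · intro N
        exact (good_of_integrable j _ (hFI N) ε hε x).aestronglyMeasurable
      · intro N
        refine Eventually.of_forall fun z => ?_
        rw [norm_mul]
        gcongr
        · exact ker_abs_le j ε hε _
        · exact hdom N z
      · refine Eventually.of_forall fun z => ?_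
        refine tendsto_const_nhds.congr' ?_
        filter_upwards [hFlim z] with N hN
        by_cases h : z ∈ HC c r
        · simp only [Set.indicator_of_mem h, hN]
        · simp only [Set.indicator_of_notMem h]
    have ht2 := (continuous_enorm.tendsto _).comp ht
    rw [← ht2.liminf_eq]
    refine liminf_le_liminf (Eventually.of_forall fun N => ?_)
    exact le_TS j ε hε _ x
  calc ∫⁻ z in Cube c r, TS j ((HC c r).indicator f) z
      ≤ ∫⁻ z in Cube c r, liminf (fun N => TS j ((HC c r).indicator (F N)) z) atTop :=
        lintegral_mono hpt
    _ ≤ liminf (fun N => ∫⁻ z in Cube c r, TS j ((HC c r).indicator (F N)) z) atTop :=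
        lintegral_liminf_le fun N => TS_meas j _ (hFI N)
    _ ≤ liminf (fun _ : ℕ => C * ∫⁻ z in HC c r, maximalR f z) atTop := by
        refine liminf_le_liminf (Eventually.of_forall fun N => ?_)
        refine (hC (F N) N (hFm N) (by positivity) (hFN N) c r hr).trans ?_
        gcongr with z
        refine maximal_mono (fun y => ?_) z
        have := hFf N y
        simp only [← Real.norm_eq_abs] at this
        exact_mod_cast this
    _ = _ := liminf_const _


theorem pt_large {n : ℕ} : ∃ C : ℝ≥0, ∀ (j : Fin n) (f : Rn n → ℝ), Measurable f → Good j f →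
    ∀ (c x y : Rn n) (r ε : ℝ), 0 < r → r ≤ ε → x ∈ Cube c r → y ∈ Cube c r →
    ‖TT j ε f y‖ₑ ≤ ‖TT j ε f x‖ₑ + C * maximalR f x := by
  obtain ⟨C1, hC1⟩ := tail_le (n := n)
  refine ⟨((n + 2) * (2 * n) * (n + 2) ^ (n + 1)) * C1, ?_⟩
  intro j f hf hG c x y r ε hr hε hx hy
  have hε0 : 0 < ε := hr.trans_le hε
  have hxy : ‖(y : Rn n) - x‖ ≤ n * (2 * r) := by
    apply norm_le_of_coord _ _ (by positivity)
    intro i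
    have h1 := abs_le.1 (hx i)
    have h2 := abs_le.1 (hy i)
    rw [PiLp.sub_apply, abs_le]
    constructor <;> linarith [h1.1, h1.2, h2.1, h2.2]
  have hm : ∀ w ∈ Cube c r, ∀ z : Rn n, (r + ‖z - c‖) / (n + 2) ≤ max ‖w - z‖ ε := by
    intro w hw z
    have h3 : ‖w - c‖ ≤ n * r := by
      have := cube_subset_ball c r hr.le hw
      rwa [Metric.mem_closedBall, dist_eq_norm] at this
    have h4 : ‖z - c‖ ≤ ‖w - z‖ + ‖w - c‖ := by
      have : z - c = -(w - z) + (w - c) := by abel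
      rw [this]
      refine (norm_add_le _ _).trans ?_
      rw [norm_neg]
    have h5 := le_max_left ‖w - z‖ ε
    have h6 := hε.trans (le_max_right ‖w - z‖ ε)
    have hn : (0 : ℝ) ≤ n := Nat.cast_nonneg n
    rw [div_le_iff₀ (by positivity)]
    nlinarith
  have hk : ∀ z, |Ker j ε (y - z) - Ker j ε (x - z)| ≤
      (n + 2) * (2 * n) * (n + 2) ^ (n + 1) * tk c r z := by
    intro z
    have hz := norm_nonneg (z - c)
    refine (ker_lip j ε (y - z) (x - z) ((r + ‖z - c‖) / (n + 2)) (by positivity)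
      (hm y hy z) (hm x hx z)).trans ?_
    have h5 : ‖y - z - (x - z)‖ ≤ n * (2 * r) := by
      have h7 : y - z - (x - z) = y - x := by abel
      rw [h7]; exact hxy
    calc (n + 2) * ‖y - z - (x - z)‖ / ((r + ‖z - c‖) / (n + 2)) ^ (n + 1)
        ≤ (n + 2) * (n * (2 * r)) / ((r + ‖z - c‖) / (n + 2)) ^ (n + 1) := by gcongr
      _ = _ := by
        unfold tk
        rw [div_pow]
        field_simp
  have e : TT j ε f y = TT j ε f x + ∫ z, (Ker j ε (y - z) - Ker j ε (x - z)) * f z := by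
    simp only [sub_mul]
    rw [integral_sub (hG ε hε0 y) (hG ε hε0 x)]
    unfold TT
    ring
  rw [e]
  refine (enorm_add_le _ _).trans ?_
  gcongr
  refine (enorm_integral_le_lintegral_enorm _).trans ?_
  have e2 : ENNReal.ofReal ((n + 2) * (2 * n) * (n + 2) ^ (n + 1)) =
      (((n + 2) * (2 * n) * (n + 2) ^ (n + 1) : ℝ≥0) : ℝ≥0∞) := by
    rw [ENNReal.ofReal_eq_coe_nnreal (by positivity)]
    rfl
  calc ∫⁻ z, ‖(Ker j ε (y - z) - Ker j ε (x - z)) * f z‖ₑ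
      ≤ ∫⁻ z, ENNReal.ofReal ((n + 2) * (2 * n) * (n + 2) ^ (n + 1)) *
          (ENNReal.ofReal (tk c r z) * ‖f z‖ₑ) := by
        refine lintegral_mono fun z => ?_
        rw [enorm_mul, Real.enorm_eq_ofReal_abs (Ker j ε (y - z) - Ker j ε (x - z)), ← mul_assoc,
          ← ENNReal.ofReal_mul (by positivity)]
        gcongr
        exact hk z
    _ = ENNReal.ofReal ((n + 2) * (2 * n) * (n + 2) ^ (n + 1)) *
          ∫⁻ z, ENNReal.ofReal (tk c r z) * ‖f z‖ₑ := lintegral_const_mul' _ _ ENNReal.ofReal_ne_top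
    _ ≤ ENNReal.ofReal ((n + 2) * (2 * n) * (n + 2) ^ (n + 1)) * (C1 * maximalR f x) := by
        gcongr
        exact hC1 _ x c r hf.enorm hr hx
    _ = _ := by
        rw [e2, ← mul_assoc, ← ENNReal.coe_mul]

theorem pt_small {n : ℕ} (j : Fin n) (f : Rn n → ℝ) (hG : Good j f)
    (c x y : Rn n) (r ε : ℝ) (hr : 0 < r) (hε : 0 < ε) (hεr : ε ≤ r) (hx : x ∈ Cube c r)
    (hy : y ∈ Cube c r) (hI : IntegrableOn f (HC c (2 * r))) :
    ‖TT j ε f y‖ₑ ≤ ‖TT j r f y‖ₑ + (TS j ((HC c (2 * r)).indicator f) y +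
      4 ^ n * maximalR f x) := by
  set g := (HC c (2 * r)).indicator f with hg
  have hgI : Integrable g := (integrable_indicator_iff (measurableSet_hc _ _)).2 hI
  have hgG := good_of_integrable j g hgI
  have hpt : ∀ z, Ker j ε (y - z) * f z - Ker j r (y - z) * f z =
      Ker j ε (y - z) * g z - Ker j r (y - z) * g z := by
    intro z
    by_cases hz : z ∈ HC c (2 * r)
    · simp only [hg, Set.indicator_of_mem hz]
    · have hn : r ≤ ‖y - z‖ := by
        simp only [HC, Set.mem_ofPred_eq, not_forall] at hz
        obtain ⟨i, hi⟩ := hz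
        refine le_trans ?_ (coord_le_norm (y - z) i)
        have h2 := abs_le.1 (hy i)
        rw [PiLp.sub_apply, le_abs]
        rw [not_and_or] at hi
        push Not at hi
        rcases hi with hi | hi
        · left; linarith [h2.1, h2.2]
        · right; linarith [h2.1, h2.2]
      have : Ker j ε (y - z) = Ker j r (y - z) := by
        unfold Ker
        rw [max_eq_left hn, max_eq_left (hεr.trans hn)]
      rw [this]; ring
  have e : TT j ε f y = TT j r f y + (TT j ε g y - TT j r g y) := by
    unfold TT
    rw [← integral_sub (hgG ε hε y) (hgG r hr y)]
    simp only [← hpt]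
    rw [integral_sub (hG ε hε y) (hG r hr y)]
    ring
  have hr4 : ‖TT j r g y‖ₑ ≤ 4 ^ n * maximalR f x := by
    unfold TT
    refine (enorm_integral_le_lintegral_enorm _).trans ?_
    calc ∫⁻ z, ‖Ker j r (y - z) * g z‖ₑ
        ≤ ∫⁻ z, (HC c (2 * r)).indicator (fun z => ENNReal.ofReal (r ^ n)⁻¹ * ‖f z‖ₑ) z := by
          refine lintegral_mono fun z => ?_
          by_cases hz : z ∈ HC c (2 * r)
          · simp only [hg, Set.indicator_of_mem hz]
            rw [enorm_mul, Real.enorm_eq_ofReal_abs (Ker j r (y - z))]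
            gcongr
            exact ker_abs_le j r hr _
          · simp [hg, Set.indicator_of_notMem hz]
      _ = ENNReal.ofReal (r ^ n)⁻¹ * ∫⁻ z in HC c (2 * r), ‖f z‖ₑ := by
          rw [lintegral_indicator (measurableSet_hc _ _),
            lintegral_const_mul' _ _ ENNReal.ofReal_ne_top]
      _ ≤ ENNReal.ofReal (r ^ n)⁻¹ * (ENNReal.ofReal ((2 * (2 * r)) ^ n) * maximalR f x) := by
          gcongr
          refine (lintegral_mono_set (hc_subset_cube _ _)).trans ?_
          exact int_cube_le _ x c (2 * r) (by positivity) (cube_mono c (by linarith) hx)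
      _ = _ := by
          rw [← mul_assoc, ← ENNReal.ofReal_mul (by positivity)]
          congr 1
          have : (r ^ n)⁻¹ * (2 * (2 * r)) ^ n = 4 ^ n := by
            have : 2 * (2 * r) = 4 * r := by ring
            rw [this, mul_pow]; field_simp
          rw [this, ENNReal.ofReal_pow (by norm_num)]
          norm_num
  rw [e]
  refine (enorm_add_le _ _).trans ?_
  gcongr
  refine enorm_sub_le.trans ?_
  gcongr
  exact le_TS j ε hε g y

theorem pt_TS {n : ℕ} : ∃ C : ℝ≥0, ∀ (j : Fin n) (f : Rn n → ℝ), Measurable f → Good j f →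
    (∀ c r, 0 < r → IntegrableOn f (HC c r)) →
    ∀ (c x y : Rn n) (r : ℝ), 0 < r → x ∈ Cube c r → y ∈ Cube c r →
    TS j f y ≤ TS j ((HC c (2 * r)).indicator f) y + (TS j f x + C * maximalR f x) := by
  obtain ⟨C, hC⟩ := pt_large (n := n)
  refine ⟨C + 4 ^ n, ?_⟩
  intro j f hf hG hI c x y r hr hx hy
  apply TS_le
  intro ε hε
  rcases le_total r ε with h | h
  · refine (hC j f hf hG c x y r ε hr h hx hy).trans ?_
    refine le_trans ?_ (le_add_self)
    gcongr
    · exact le_TS j ε hε f x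
    · simp
  · refine (pt_small j f hG c x y r ε hr hε h hx hy (hI c _ (by positivity))).trans ?_
    have h1 := hC j f hf hG c x y r r hr le_rfl hx hy
    have h2 := le_TS j r hr f x
    calc _ ≤ (TS j f x + C * maximalR f x) + (TS j ((HC c (2 * r)).indicator f) y +
          4 ^ n * maximalR f x) := by
          gcongr
          exact h1.trans (by gcongr)
      _ = _ := by push_cast; ring

theorem pt_max {n : ℕ} (j : Fin n) (C0 : ℝ≥0) (hC0 : LocalBd j (2 * n) C0) :
    ∃ C : ℝ≥0, ∀ (f : Rn n → ℝ), Measurable f → Good j f →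
    (∀ c r, 0 < r → IntegrableOn f (HC c r)) → ∀ x,
    maximal (rieszMax j f) x ≤ C * rieszMax j f x + (C * maximalR f x +
      C * maximal (maximalR f) x) := by
  obtain ⟨D, hD⟩ := pt_TS (n := n)
  obtain ⟨C4, hC4⟩ := local_full j C0 hC0
  set k := (rieszConst n).toNNReal with hk
  set k' := ((rieszConst n)⁻¹).toNNReal with hk'
  have main : ∀ (f : Rn n → ℝ), Measurable f → Good j f →
    (∀ c r, 0 < r → IntegrableOn f (HC c r)) → ∀ x,
    maximal (rieszMax j f) x ≤ k * (C4 * 2 ^ n * maximal (maximalR f) x +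
      ((TS j f x + D * maximalR f x) + 2 ^ n * maximal (maximalR f) x)) := by
    intro f hf hG hI x
    apply maximal_le
    intro c r hr hx
    set g := (HC c (2 * r)).indicator f with hg
    have hgI : Integrable g := (integrable_indicator_iff (measurableSet_hc _ _)).2
      (hI c _ (by positivity))
    set V := TS j f x + D * maximalR f x with hV
    have hx2 : x ∈ Cube c (2 * r) := cube_mono c (by linarith) hx
    have h1 : ∫⁻ y in Cube c r, TS j g y ≤
        C4 * (ENNReal.ofReal ((2 * (2 * r)) ^ n) * maximal (maximalR f) x) := by
      calc ∫⁻ y in Cube c r, TS j g y ≤ ∫⁻ y in Cube c (2 * r), TS j g y :=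
            lintegral_mono_set (cube_mono c (by linarith))
        _ ≤ C4 * ∫⁻ z in HC c (2 * r), maximalR f z :=
            hC4 f hf c (2 * r) (by positivity) (hI c _ (by positivity))
        _ ≤ C4 * ∫⁻ z in Cube c (2 * r), maximalR f z := by
            gcongr
            exact hc_subset_cube _ _
        _ ≤ _ := by
            gcongr
            exact int_cube_le _ x c (2 * r) (by positivity) hx2
    have e4 : ENNReal.ofReal ((2 * (2 * r)) ^ n) = 2 ^ n * ENNReal.ofReal ((2 * r) ^ n) := by
      rw [mul_pow, ENNReal.ofReal_mul (by positivity), ENNReal.ofReal_pow (by norm_num)]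
      norm_num
    have h2 : ∫⁻ y in Cube c r, maximalR f y ≤
        ENNReal.ofReal ((2 * r) ^ n) * maximal (maximalR f) x := int_cube_le _ x c r hr hx
    calc ∫⁻ y in Cube c r, rieszMax j f y
        ≤ ∫⁻ y in Cube c r, k * (TS j g y + (V + 2 ^ n * maximalR f y)) := by
          apply setLIntegral_mono' (measurableSet_cube _ _)
          intro y hy
          refine (rieszMax_le j f hG y).trans ?_
          have h9 := hD j f hf hG hI c x y r hr hx hy
          rw [← add_assoc (TS j g y)]
          exact mul_le_mul' le_rfl (add_le_add h9 le_rfl)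
      _ = k * ((∫⁻ y in Cube c r, TS j g y) + (V * ENNReal.ofReal ((2 * r) ^ n) +
            2 ^ n * ∫⁻ y in Cube c r, maximalR f y)) := by
          rw [lintegral_const_mul' _ _ ENNReal.coe_ne_top, lintegral_add_left (TS_meas j g hgI),
            lintegral_add_left measurable_const, setLIntegral_const, volume_cube _ _ hr,
            lintegral_const_mul' _ _ (by finiteness)]
      _ ≤ k * (C4 * (ENNReal.ofReal ((2 * (2 * r)) ^ n) * maximal (maximalR f) x) +
            (V * ENNReal.ofReal ((2 * r) ^ n) +
            2 ^ n * (ENNReal.ofReal ((2 * r) ^ n) * maximal (maximalR f) x))) := by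
          gcongr
      _ = _ := by
          rw [e4]; ring
  refine ⟨k * k' + (k * (2 ^ n + D) + k * (C4 * 2 ^ n + 2 ^ n)), ?_⟩
  intro f hf hG hI x
  refine (main f hf hG hI x).trans ?_
  have h3 := TS_le_rieszMax j f hG x
  calc _ ≤ k * (C4 * 2 ^ n * maximal (maximalR f) x +
      (((k' * rieszMax j f x + 2 ^ n * maximalR f x) + D * maximalR f x) +
        2 ^ n * maximal (maximalR f) x)) := by gcongr
    _ = ((k * k' : ℝ≥0) : ℝ≥0∞) * rieszMax j f x +
        (((k * (2 ^ n + D) : ℝ≥0) : ℝ≥0∞) * maximalR f x +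
          ((k * (C4 * 2 ^ n + 2 ^ n) : ℝ≥0) : ℝ≥0∞) * maximal (maximalR f) x) := by
        push_cast; ring
    _ ≤ _ := by
        gcongr
        · exact le_self_add
        · exact le_add_left le_self_add
        · exact le_add_left le_add_self

theorem locint {n : ℕ} (f : Rn n → ℝ) (hf : Measurable f)
    (hw : ∫⁻ z, ENNReal.ofReal (tk 0 1 z) * ‖f z‖ₑ < ⊤) (c : Rn n) (r : ℝ) (hr : 0 < r) :
    IntegrableOn f (HC c r) := by
  refine ⟨hf.aestronglyMeasurable, ?_⟩
  rw [hasFiniteIntegral_iff_enorm]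
  set L := ‖c‖ + n * r with hL
  have hL0 : 0 ≤ L := by positivity
  calc ∫⁻ z in HC c r, ‖f z‖ₑ
      ≤ ∫⁻ z in HC c r, ENNReal.ofReal ((1 + L) ^ (n + 1)) *
          (ENNReal.ofReal (tk 0 1 z) * ‖f z‖ₑ) := by
        apply setLIntegral_mono' (measurableSet_hc _ _)
        intro z hz
        rw [← mul_assoc, ← ENNReal.ofReal_mul (by positivity)]
        have hzL : ‖z‖ ≤ L := by
          have := cube_subset_ball c r hr.le (hc_subset_cube _ _ hz)
          rw [Metric.mem_closedBall, dist_eq_norm] at this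
          have h2 := norm_le_norm_add_norm_sub c z
          rw [norm_sub_rev] at h2
          rw [hL]; linarith
        have h1 : 1 ≤ (1 + L) ^ (n + 1) * tk 0 1 z := by
          unfold tk
          rw [sub_zero, mul_one_div, one_le_div (by positivity)]
          gcongr
        calc ‖f z‖ₑ = ENNReal.ofReal 1 * ‖f z‖ₑ := by simp
          _ ≤ _ := by gcongr
    _ ≤ ∫⁻ z, ENNReal.ofReal ((1 + L) ^ (n + 1)) *
          (ENNReal.ofReal (tk 0 1 z) * ‖f z‖ₑ) := setLIntegral_le_lintegral _ _
    _ = ENNReal.ofReal ((1 + L) ^ (n + 1)) * ∫⁻ z, ENNReal.ofReal (tk 0 1 z) * ‖f z‖ₑ :=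
        lintegral_const_mul' _ _ ENNReal.ofReal_ne_top
    _ < ⊤ := ENNReal.mul_lt_top ENNReal.ofReal_lt_top hw

theorem weight_fin {n : ℕ} (X : BFSNorm n) (f : Rn n → ℝ) (hf : Measurable f)
    (hfin : X.ρ (maximalR f) < ⊤) : ∫⁻ z, ENNReal.ofReal (tk 0 1 z) * ‖f z‖ₑ < ⊤ := by
  obtain ⟨C1, hC1⟩ := tail_le (n := n)
  obtain ⟨cE, hcE⟩ := X.int_le (Cube 0 1) (measurableSet_cube _ _)
    (isBounded_cube _ _ zero_le_one)
  set I := ∫⁻ z, ENNReal.ofReal (tk (0 : Rn n) 1 z) * ‖f z‖ₑ with hI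
  have h1 := hcE ((Cube (0 : Rn n) 1).indicator fun _ => I)
    (measurable_const.indicator (measurableSet_cube _ _))
  have h2 : X.ρ ((Cube (0 : Rn n) 1).indicator fun _ => I) ≤ C1 * X.ρ (maximalR f) := by
    rw [← X.smul]
    apply X.mono
    refine Eventually.of_forall fun x => ?_
    by_cases h : x ∈ Cube (0 : Rn n) 1
    · rw [Set.indicator_of_mem h]
      exact hC1 _ x 0 1 hf.enorm one_pos h
    · rw [Set.indicator_of_notMem h]; exact zero_le
  rw [setLIntegral_indicator (measurableSet_cube _ _), Set.inter_self, setLIntegral_const] at h1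
  have h3 : I * volume (Cube (0 : Rn n) 1) < ⊤ := by
    refine (h1.trans (mul_le_mul_right h2 _)).trans_lt ?_
    exact ENNReal.mul_lt_top ENNReal.coe_lt_top (ENNReal.mul_lt_top ENNReal.coe_lt_top hfin)
  by_contra h
  rw [not_lt, top_le_iff] at h
  rw [h, ENNReal.top_mul (vol_ne_zero _ _ one_pos)] at h3
  exact lt_irrefl _ h3

theorem single {n : ℕ} (X : BFSNorm n) (j : Fin n)
    (hφ : X.ρ (fun x => ENNReal.ofReal (1 / (1 + ‖x‖ ^ n))) < ⊤)
    (hMMX : ∃ C₀ : ℝ≥0, 0 < C₀ ∧ ∀ f : Rn n → ℝ, Measurable f →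
      X.ρ (maximal (maximalR f)) ≤ (C₀ : ℝ≥0∞) * X.ρ (maximalR f))
    (hCF : ∃ C : ℝ≥0, 0 < C ∧ ∀ f : Rn n → ℝ, Measurable f →
      X.ρ (rieszMax j f) ≤ (C : ℝ≥0∞) * X.ρ (maximalR f)) :
    ∃ C : ℝ≥0, 0 < C ∧ ∀ f : Rn n → ℝ, Measurable f →
      X.ρ (maximal (rieszMax j f)) ≤ (C : ℝ≥0∞) * X.ρ (maximalR f) := by
  obtain ⟨C0, hC0⟩ := local_scaled X j hφ hCF (2 * n) (by positivity)
  obtain ⟨C, hC⟩ := pt_max j C0 hC0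
  obtain ⟨Ca, -, hCa⟩ := hMMX
  obtain ⟨Cb, -, hCb⟩ := hCF
  refine ⟨C * Cb + (C + C * Ca) + 1, by positivity, ?_⟩
  intro f hf
  by_cases hfin : X.ρ (maximalR f) = ⊤
  · rw [hfin, ENNReal.mul_top]
    · exact le_top
    · simp
  have hw := weight_fin X f hf (lt_top_iff_ne_top.2 hfin)
  rcases good_or j f hf hw with hG | h0
  · calc X.ρ (maximal (rieszMax j f)) ≤ X.ρ (fun x => C * rieszMax j f x + (C * maximalR f x +
          C * maximal (maximalR f) x)) :=
          X.mono _ _ (Eventually.of_forall (hC f hf hG (locint f hf hw)))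
      _ ≤ C * X.ρ (rieszMax j f) + (C * X.ρ (maximalR f) + C * X.ρ (maximal (maximalR f))) := by
          refine (X.add_le _ _).trans (add_le_add (X.smul _ _).le ((X.add_le _ _).trans ?_))
          exact add_le_add (X.smul _ _).le (X.smul _ _).le
      _ ≤ C * (Cb * X.ρ (maximalR f)) + (C * X.ρ (maximalR f) + C * (Ca * X.ρ (maximalR f))) := by
          gcongr
          · exact hCb f hf
          · exact hCa f hf
      _ = ((C * Cb + (C + C * Ca) : ℝ≥0) : ℝ≥0∞) * X.ρ (maximalR f) := by push_cast; ring
      _ ≤ _ := by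
          exact mul_le_mul' (ENNReal.coe_le_coe.2 le_self_add) le_rfl
  · have e : maximal (rieszMax j f) = fun x => ((0 : ℝ≥0) : ℝ≥0∞) * maximalR f x := by
      funext x
      have : rieszMax j f = fun _ => 0 := funext h0
      rw [this]
      simp [maximal]
    rw [e, X.smul]
    simp


/-- step in the proof of Theorem 1.1. If `x ↦ 1/(1+|x|ⁿ) ∈ X`,
`M` is bounded on `MX`, and the Coifman–Fefferman inequality
`‖R_j^⋆ f‖_X ≤ C ‖Mf‖_X` holds for each maximal Riesz transform, then each
`R_j^⋆` is bounded on `MX`: `‖M(R_j^⋆ f)‖_X ≤ C'' ‖Mf‖_X`. -/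
theorem rieszMax_bounded_on_MX (n : ℕ) (X : BFSNorm n)
    (hφ : X.ρ (fun x => ENNReal.ofReal (1 / (1 + ‖x‖ ^ n))) < ⊤)
    (hMMX : ∃ C₀ : ℝ≥0, 0 < C₀ ∧ ∀ f : Rn n → ℝ, Measurable f →
      X.ρ (maximal (maximalR f)) ≤ (C₀ : ℝ≥0∞) * X.ρ (maximalR f))
    (hCF : ∀ j : Fin n, ∃ C : ℝ≥0, 0 < C ∧ ∀ f : Rn n → ℝ, Measurable f →
      X.ρ (rieszMax j f) ≤ (C : ℝ≥0∞) * X.ρ (maximalR f)) :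
    ∃ C'' : ℝ≥0, 0 < C'' ∧ ∀ (j : Fin n) (f : Rn n → ℝ), Measurable f →
      X.ρ (maximal (rieszMax j f)) ≤ (C'' : ℝ≥0∞) * X.ρ (maximalR f) := by
  choose C hC0 hC using fun j => single X j hφ hMMX (hCF j)
  refine ⟨1 + ∑ j, C j, by positivity, fun j f hf => (hC j f hf).trans ?_⟩
  have : C j ≤ 1 + ∑ j, C j :=
    le_add_left (Finset.single_le_sum (f := C) (fun _ _ => zero_le) (Finset.mem_univ j))
  exact mul_le_mul' (ENNReal.coe_le_coe.2 this) le_rfl
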